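/- arXiv:1210.6721 — 2 statements merged into one kernel-verified Lean document; each statement's English description precedes it below -/
import Mathlib

section
/- Let p be a prime, let m ≥ n + 1 ≥ 2 be integers, let F_1, …, F_n ∈ ℤ[X_1, …, X_m], and let X_p ⊆ {0, …, p−1}^m be the set of solutions of the simultaneous congruences F_j(x) ≡ 0 (mod p), j = 1, …, n. Suppose there are constants ν ≥ 1 and A > 0 such that: (i) |#X_p − ν p^{m−n}| ≤ A p^{m−n−1/2}; and (ii) for every integer k with 1 ≤ k ≤ p, every γ ∈ ℝ^m and every u ∈ ℤ^m, the number T_p(C) of points x ∈ X_p with x/p lying in the cube C = ∏_{j=1}^m [γ_j + u_j/k, γ_j + (u_j+1)/k] (taken modulo 1 in 𝕋_m) satisfies |T_p(C) − #X_p · k^{−m}| ≤ A (p^{(m−n)/2}(log p)^m + k^{−(m−n−1)} p^{m−n−1/2}(log p)^{n+1}). Then for every very well shaped set Ω ⊆ 𝕋_m with constant C, the number T_p(Ω) of points x ∈ X_p with x/p ∈ Ω satisfies |T_p(Ω) − #X_p · μ(Ω)| ≤ c · #X_p · (μ(Ω)^{1−1/m} p^{−1/(2(n+1))} log p + p^{−1/2}(log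 p)^{n+2}), where c depends only on m, n, ν, A and C. -/
open MeasureTheory

noncomputable section

abbrev Torus (m : ℕ) : Type := Fin m → AddCircle (1 : ℝ)

noncomputable def tmeas {m : ℕ} (Ω : Set (Torus m)) : ℝ := (volume Ω).toReal

noncomputable def torusDist {m : ℕ} (u w : Torus m) : ℝ :=
  Real.sqrt (∑ i, dist (u i) (w i) ^ 2)

noncomputable def torusDistSet {m : ℕ} (u : Torus m) (Ω : Set (Torus m)) : ℝ :=
  ⨅ w : Ω, torusDist u (w : Torus m)

def outerShell {m : ℕ} (Ω : Set (Torus m)) (ε : ℝ) : Set (Torus m) :=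
  {u | u ∉ Ω ∧ torusDistSet u Ω < ε}

def innerShell {m : ℕ} (Ω : Set (Torus m)) (ε : ℝ) : Set (Torus m) :=
  {u | u ∈ Ω ∧ torusDistSet u Ωᶜ < ε}

def IsWellShaped {m : ℕ} (Ω : Set (Torus m)) (C : ℝ) : Prop :=
  ∀ ε : ℝ, 0 < ε →
    tmeas (outerShell Ω ε) ≤ C * ε ∧ tmeas (innerShell Ω ε) ≤ C * ε

def IsVeryWellShaped {m : ℕ} (Ω : Set (Torus m)) (C : ℝ) : Prop :=
  ∀ ε : ℝ, 0 < ε →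
    tmeas (outerShell Ω ε) ≤ C * (tmeas Ω ^ (1 - 1 / (m : ℝ)) * ε + ε ^ m) ∧
    tmeas (innerShell Ω ε) ≤ C * (tmeas Ω ^ (1 - 1 / (m : ℝ)) * ε + ε ^ m)

noncomputable def discrepancy {ι : Type*} {n : ℕ} (s : Set ι) (ξ : ι → Fin n → ℝ) : ℝ :=
  if s.ncard = 0 then 1
  else
    ⨆ B : {B : (Fin n → ℝ) × (Fin n → ℝ) // ∀ j, 0 ≤ B.1 j ∧ B.1 j ≤ B.2 j ∧ B.2 j ≤ 1},
      |((s ∩ {k | ∀ j, B.val.1 j ≤ ξ k j ∧ ξ k j < B.val.2 j}).ncard : ℝ) / (s.ncard : ℝ)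
        - ∏ j, (B.val.2 j - B.val.1 j)|

noncomputable def torusPt (p : ℕ) {m : ℕ} (x : Fin m → Fin p) : Torus m :=
  fun i => ((((x i : ℕ) : ℝ) / (p : ℝ) : ℝ) : AddCircle (1 : ℝ))

noncomputable def fracPt {p m n : ℕ} (G : Fin n → MvPolynomial (Fin m) (ZMod p))
    (x : Fin m → ℤ) : Fin n → ℝ :=
  fun j => ((MvPolynomial.eval (fun i => ((x i : ℤ) : ZMod p)) (G j)).val : ℝ) / (p : ℝ)

def Degree2Independent {p m n : ℕ} (G : Fin n → MvPolynomial (Fin m) (ZMod p)) : Prop :=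
  ∀ a : Fin n → ZMod p, a ≠ 0 → 2 ≤ (∑ j, a j • G j).totalDegree

def torusIcc (a b : ℝ) : Set (AddCircle (1 : ℝ)) :=
  (fun r : ℝ => (r : AddCircle (1 : ℝ))) '' Set.Icc a b

def gridCube {m : ℕ} (γ : Fin m → ℝ) (k : ℕ) (u : Fin m → ℤ) : Set (Torus m) :=
  {t | ∀ i, t i ∈ torusIcc (γ i + (u i : ℝ) / k) (γ i + ((u i : ℝ) + 1) / k)}

def torusCube {m : ℕ} (γ : Fin m → ℝ) (s : ℝ) : Set (Torus m) :=
  {t | ∀ i, t i ∈ torusIcc (γ i) (γ i + s)}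

def cubesIn {m : ℕ} (Ω : Set (Torus m)) (γ : Fin m → ℝ) (k : ℕ) : Set (Set (Torus m)) :=
  {Γ | (∃ u : Fin m → ℤ, Γ = gridCube γ k u) ∧ Γ ⊆ Ω}

def dyadicB {m : ℕ} (Ω : Set (Torus m)) (γ : Fin m → ℝ) (i : ℕ) : Set (Set (Torus m)) :=
  if i = 1 then cubesIn Ω γ 2
  else {Γ | Γ ∈ cubesIn Ω γ (2 ^ i) ∧ ∀ Γ' ∈ cubesIn Ω γ (2 ^ (i - 1)), ¬ Γ ⊆ Γ'}

def polySolutions (p : ℕ) {m n : ℕ} (F : Fin n → MvPolynomial (Fin m) ℤ) :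
    Set (Fin m → Fin p) :=
  {x | ∀ j, ((MvPolynomial.eval (fun i => ((x i : ℕ) : ℤ)) (F j) : ℤ) : ZMod p) = 0}

noncomputable def Tcount (p : ℕ) {m n : ℕ} (F : Fin n → MvPolynomial (Fin m) ℤ)
    (S : Set (Torus m)) : ℕ :=
  (polySolutions p F ∩ {x | torusPt p x ∈ S}).ncard

end


open Set in
noncomputable def rr (t : AddCircle (1 : ℝ)) : ℝ :=
  (AddCircle.equivIco (1:ℝ) (Real.sqrt 2) t : ℝ) - Real.sqrt 2

lemma rr_nonneg (t : AddCircle (1 : ℝ)) : 0 ≤ rr t := by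
  have := (AddCircle.equivIco (1:ℝ) (Real.sqrt 2) t).2.1
  unfold rr; linarith

lemma rr_lt_one (t : AddCircle (1 : ℝ)) : rr t < 1 := by
  have := (AddCircle.equivIco (1:ℝ) (Real.sqrt 2) t).2.2
  unfold rr; linarith

lemma rr_coe (t : AddCircle (1 : ℝ)) : ((Real.sqrt 2 + rr t : ℝ) : AddCircle (1:ℝ)) = t := by
  unfold rr
  rw [add_sub_cancel]
  exact AddCircle.coe_equivIco

lemma rr_of_mem {s : ℝ} (h0 : 0 ≤ s) (h1 : s < 1) :
    rr ((Real.sqrt 2 + s : ℝ) : AddCircle (1:ℝ)) = s := by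
  unfold rr
  rw [AddCircle.equivIco_coe_of_mem]
  · ring
  · constructor <;> linarith

lemma rr_measurable : Measurable rr := by
  unfold rr
  have := (AddCircle.measurableEquivIco (1:ℝ) (Real.sqrt 2)).measurable
  exact (measurable_subtype_coe.comp this).sub_const _

noncomputable def idx (k : ℕ) (t : AddCircle (1 : ℝ)) : ℕ := ⌊(k:ℝ) * rr t⌋₊

lemma idx_measurable (k : ℕ) : Measurable (idx k) :=
  Nat.measurable_floor.comp (rr_measurable.const_mul _)

lemma idx_lt {k : ℕ} (hk : 1 ≤ k) (t : AddCircle (1 : ℝ)) : idx k t < k := by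
  have hk' : (1:ℝ) ≤ k := by exact_mod_cast hk
  unfold idx
  rw [Nat.floor_lt (mul_nonneg (by linarith) (rr_nonneg t))]
  nlinarith [rr_lt_one t]

lemma idx_eq_iff {k : ℕ} (hk : 1 ≤ k) (t : AddCircle (1 : ℝ)) (u : ℕ) :
    idx k t = u ↔ (u:ℝ) / k ≤ rr t ∧ rr t < ((u:ℝ) + 1) / k := by
  have hk' : (0:ℝ) < k := by exact_mod_cast hk
  unfold idx
  rw [Nat.floor_eq_iff (mul_nonneg (by linarith) (rr_nonneg t)), div_le_iff₀ hk', lt_div_iff₀ hk',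
    mul_comm]

lemma idx_half (k : ℕ) (t : AddCircle (1 : ℝ)) : idx k t = idx (2 * k) t / 2 := by
  unfold idx
  rw [← Nat.floor_div_ofNat]
  congr 1
  push_cast
  ring

lemma dist_le_of_idx {k : ℕ} (hk : 1 ≤ k) {s t : AddCircle (1 : ℝ)} (h : idx k s = idx k t) :
    dist s t ≤ 1 / k := by
  have h1 := (idx_eq_iff hk s _).1 h
  have h2 := (idx_eq_iff hk t _).1 rfl
  have : dist s t ≤ |rr s - rr t| := by
    rw [dist_eq_norm]
    conv_lhs => rw [← rr_coe s, ← rr_coe t, ← AddCircle.coe_sub]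
    refine le_trans (QuotientAddGroup.norm_mk_le_norm) ?_
    rw [Real.norm_eq_abs]
    apply le_of_eq
    congr 1
    ring
  refine this.trans ?_
  rw [add_div] at h1 h2
  rw [abs_le]; constructor <;> linarith

lemma idx_volume {k : ℕ} (hk : 1 ≤ k) {u : ℕ} (hu : u < k) :
    volume {t : AddCircle (1:ℝ) | idx k t = u} = ENNReal.ofReal (1 / k) := by
  have hk' : (0:ℝ) < k := by exact_mod_cast hk
  have hms : MeasurableSet {t : AddCircle (1:ℝ) | idx k t = u} :=
    idx_measurable k (measurableSet_singleton u)
  rw [← (AddCircle.measurePreserving_mk (1:ℝ) (Real.sqrt 2)).measure_preimage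
    hms.nullMeasurableSet,
    Measure.restrict_congr_set (Ico_ae_eq_Ioc).symm, Measure.restrict_apply
      ((AddCircle.measurePreserving_mk (1:ℝ) (Real.sqrt 2)).measurable hms)]
  have hu' : ((u:ℝ) + 1) / k ≤ 1 := by
    rw [div_le_one hk']; exact_mod_cast hu
  have hu0 : 0 ≤ (u:ℝ) / k := by positivity
  have : ((fun x : ℝ => (x : AddCircle (1:ℝ))) ⁻¹' {t : AddCircle (1:ℝ) | idx k t = u} ∩
      Set.Ico (Real.sqrt 2) (Real.sqrt 2 + 1)) =
      Set.Ico (Real.sqrt 2 + (u:ℝ) / k) (Real.sqrt 2 + ((u:ℝ) + 1) / k) := by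
    ext x
    simp only [Set.mem_inter_iff, Set.mem_preimage, Set.mem_ofPred_eq, Set.mem_Ico]
    constructor
    · rintro ⟨h, h1, h2⟩
      rw [idx_eq_iff hk, show x = Real.sqrt 2 + (x - Real.sqrt 2) by ring,
        rr_of_mem (by linarith) (by linarith)] at h
      constructor <;> linarith [h.1, h.2]
    · rintro ⟨h1, h2⟩
      refine ⟨?_, by linarith, by linarith⟩
      rw [idx_eq_iff hk, show x = Real.sqrt 2 + (x - Real.sqrt 2) by ring,
        rr_of_mem (by linarith) (by linarith)]
      constructor <;> linarith
  rw [this, Real.volume_Ico]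
  congr 1
  ring

noncomputable def cidx {m : ℕ} (k : ℕ) (t : Torus m) : Fin m → ℕ := fun j => idx k (t j)

lemma cidx_measurable {m : ℕ} (k : ℕ) : Measurable (cidx (m := m) k) :=
  measurable_pi_lambda _ fun j => (idx_measurable k).comp (measurable_pi_apply j)

lemma cidx_volume {m : ℕ} {k : ℕ} (hk : 1 ≤ k) {u : Fin m → ℕ} (hu : ∀ j, u j < k) :
    volume.real (cidx k ⁻¹' {u} : Set (Torus m)) = 1 / (k:ℝ) ^ m := by
  have : (cidx k ⁻¹' {u} : Set (Torus m)) =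
      Set.univ.pi fun j => {t : AddCircle (1:ℝ) | idx k t = u j} := by
    ext t
    simp [cidx, funext_iff]
  rw [this, Measure.real, volume_pi_pi]
  simp_rw [idx_volume hk (hu _)]
  simp

lemma cidx_count {m n : ℕ} (p : ℕ) (F : Fin n → MvPolynomial (Fin m) ℤ)
    {k : ℕ} (hk : 1 ≤ k) {u : Fin m → ℕ} (hu : ∀ j, u j < k) :
    Tcount p F (cidx k ⁻¹' {u}) =
      Tcount p F (gridCube (fun _ => Real.sqrt 2) k (fun j => (u j : ℤ))) := by
  have hk' : (0:ℝ) < k := by exact_mod_cast hk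
  unfold Tcount
  congr 1
  ext x
  simp only [Set.mem_inter_iff, and_congr_right_iff, Set.mem_ofPred_eq, Set.mem_preimage,
    Set.mem_singleton_iff, cidx, funext_iff, gridCube]
  intro _
  refine forall_congr' fun j => ?_
  rw [idx_eq_iff hk]
  have hu' : ((u j:ℝ) + 1) / k ≤ 1 := by
    rw [div_le_one hk']; exact_mod_cast hu j
  have hu0 : 0 ≤ (u j:ℝ) / k := by positivity
  constructor
  · rintro ⟨h1, h2⟩
    refine ⟨Real.sqrt 2 + rr (torusPt p x j), ⟨?_, ?_⟩, rr_coe _⟩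
    · push_cast; linarith
    · push_cast; linarith
  · rintro ⟨s, ⟨h1, h2⟩, hs⟩
    push_cast at h1 h2
    have hq : ∃ q : ℚ, s = q := by
      simp only [torusPt] at hs
      rw [← sub_eq_zero, ← AddCircle.coe_sub, AddCircle.coe_eq_zero_iff] at hs
      obtain ⟨z, hz⟩ := hs
      refine ⟨z + (x j : ℕ) / p, ?_⟩
      push_cast
      simp only [zsmul_eq_mul, mul_one] at hz
      linarith
    obtain ⟨q, rfl⟩ := hq
    have key : ∀ v : ℚ, Real.sqrt 2 + v ≠ (q:ℝ) := fun v h =>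
      (irrational_sqrt_two.add_ratCast v) ⟨q, h.symm⟩
    have k1 : Real.sqrt 2 + (u j:ℝ) / k < q :=
      lt_of_le_of_ne h1 (by simpa using key ((u j:ℚ) / k))
    have k2 : (q:ℝ) < Real.sqrt 2 + ((u j:ℝ) + 1) / k :=
      lt_of_le_of_ne h2 (by simpa using (key (((u j:ℚ) + 1)/ k)).symm)
    rw [← hs]
    simp only
    rw [show (q:ℝ) = Real.sqrt 2 + (q - Real.sqrt 2) by ring,
        rr_of_mem (by linarith) (by linarith)]
    constructor <;> linarith

lemma Tcount_union {m n : ℕ} (p : ℕ) (F : Fin n → MvPolynomial (Fin m) ℤ)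
    {S S' : Set (Torus m)} (h : Disjoint S S') :
    Tcount p F (S ∪ S') = Tcount p F S + Tcount p F S' := by
  unfold Tcount
  rw [← Set.ncard_union_eq _ (Set.toFinite _) (Set.toFinite _)]
  · congr 1
    ext x
    simp only [Set.mem_inter_iff, Set.mem_union, Set.mem_ofPred_eq]
    tauto
  · rw [Set.disjoint_left] at h ⊢
    rintro x ⟨_, h1⟩ ⟨_, h2⟩
    exact h h1 h2

lemma Tcount_mono {m n : ℕ} (p : ℕ) (F : Fin n → MvPolynomial (Fin m) ℤ)
    {S S' : Set (Torus m)} (h : S ⊆ S') : Tcount p F S ≤ Tcount p F S' := by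
  unfold Tcount
  exact Set.ncard_le_ncard (fun x hx => ⟨hx.1, h hx.2⟩) (Set.toFinite _)

lemma Tcount_univ {m n : ℕ} (p : ℕ) (F : Fin n → MvPolynomial (Fin m) ℤ) :
    Tcount p F Set.univ = (polySolutions p F).ncard := by
  unfold Tcount
  congr 1
  ext x; simp

lemma cells_finset {m n : ℕ} (p : ℕ) (F : Fin n → MvPolynomial (Fin m) ℤ)
    {k : ℕ} (hk : 1 ≤ k) (N e : ℝ)
    (he : ∀ u : Fin m → ℕ, (∀ j, u j < k) →
      |(Tcount p F (cidx k ⁻¹' {u}) : ℝ) - N / (k:ℝ) ^ m| ≤ e)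
    (V : Finset (Fin m → ℕ)) :
    (∀ v ∈ V, ∀ j, v j < k) →
    volume.real (cidx k ⁻¹' (V : Set (Fin m → ℕ)) : Set (Torus m)) = V.card / (k:ℝ) ^ m ∧
    V.card * (N / (k:ℝ) ^ m - e) ≤ Tcount p F (cidx k ⁻¹' (V : Set (Fin m → ℕ))) := by
  classical
  induction V using Finset.induction_on with
  | empty => intro _; simp
  | insert v V hv ih =>
    intro h
    obtain ⟨h1, h2⟩ := ih fun w hw => h w (Finset.mem_insert_of_mem hw)
    have hvk := h v (Finset.mem_insert_self v V)
    have hd : Disjoint (cidx k ⁻¹' {v} : Set (Torus m))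
        (cidx k ⁻¹' (V : Set (Fin m → ℕ))) := by
      apply Disjoint.preimage
      simpa using hv
    have hset : (cidx k ⁻¹' ((insert v V : Finset _) : Set (Fin m → ℕ)) : Set (Torus m)) =
        cidx k ⁻¹' {v} ∪ cidx k ⁻¹' (V : Set (Fin m → ℕ)) := by
      rw [← Set.preimage_union, Finset.coe_insert, Set.insert_eq]
    rw [hset, Tcount_union p F hd, measureReal_union hd
      (cidx_measurable k (Finset.measurableSet V)), h1, cidx_volume hk hvk,
      Finset.card_insert_of_notMem hv]
    have := (abs_le.1 (he v hvk)).1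
    push_cast
    constructor
    · ring
    · linarith

lemma cells_set {m n : ℕ} (p : ℕ) (F : Fin n → MvPolynomial (Fin m) ℤ)
    {k : ℕ} (hk : 1 ≤ k) (N e : ℝ)
    (he : ∀ u : Fin m → ℕ, (∀ j, u j < k) →
      |(Tcount p F (cidx k ⁻¹' {u}) : ℝ) - N / (k:ℝ) ^ m| ≤ e)
    (U : Set (Fin m → ℕ)) :
    N * volume.real (cidx k ⁻¹' U : Set (Torus m))
      - volume.real (cidx k ⁻¹' U : Set (Torus m)) * (k:ℝ) ^ m * e
      ≤ Tcount p F (cidx k ⁻¹' U) := by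
  classical
  have hk' : (0:ℝ) < k := by exact_mod_cast hk
  set V := (Fintype.piFinset (fun _ : Fin m => Finset.range k)).filter (· ∈ U) with hV
  have hset : (cidx k ⁻¹' U : Set (Torus m)) = cidx k ⁻¹' (V : Set (Fin m → ℕ)) := by
    ext t
    simp only [Set.mem_preimage, hV, Finset.coe_filter, Set.mem_ofPred_eq, Fintype.mem_piFinset,
      Finset.mem_range]
    exact ⟨fun h => ⟨fun j => idx_lt hk _, h⟩, fun h => h.2⟩
  obtain ⟨h1, h2⟩ := cells_finset p F hk N e he V (by
    intro v hv
    simpa [hV] using (Finset.mem_filter.1 hv).1)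
  rw [hset, h1]
  refine le_trans (le_of_eq ?_) h2
  field_simp

def GG {m : ℕ} (S : Set (Torus m)) (k : ℕ) : Set (Torus m) :=
  cidx k ⁻¹' {u | ∀ t', cidx k t' = u → t' ∈ S}

lemma GG_sub {m : ℕ} (S : Set (Torus m)) (k : ℕ) : GG S k ⊆ S := fun t ht => ht t rfl

lemma cidx_half {m : ℕ} (k : ℕ) (t : Torus m) : cidx k t = fun j => cidx (2 * k) t j / 2 := by
  ext j; exact idx_half k (t j)

lemma GG_mono {m : ℕ} (S : Set (Torus m)) (k : ℕ) : GG S k ⊆ GG S (2 * k) := by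
  intro t ht t' h
  refine ht t' ?_
  rw [cidx_half, cidx_half k t, h]

lemma GG_diff {m : ℕ} (S : Set (Torus m)) (k : ℕ) : ∃ U : Set (Fin m → ℕ),
    GG S (2 * k) \ GG S k = cidx (2 * k) ⁻¹' U := by
  refine ⟨{u | ∀ t', cidx (2*k) t' = u → t' ∈ S} \
    {u | ∀ t', cidx k t' = (fun j => u j / 2) → t' ∈ S}, ?_⟩
  rw [Set.preimage_sdiff]
  congr 1
  ext t
  simp only [GG, Set.mem_preimage, Set.mem_ofPred_eq]
  rw [← cidx_half]

lemma diff_shell {m : ℕ} (S : Set (Torus m)) {k : ℕ} (hk : 1 ≤ k) :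
    S \ GG S k ⊆ innerShell S (((m:ℝ) + 1) / k) := by
  have hk' : (0:ℝ) < k := by exact_mod_cast hk
  rintro t ⟨ht, hG⟩
  refine ⟨ht, ?_⟩
  simp only [GG, Set.mem_preimage, Set.mem_ofPred_eq] at hG
  push Not at hG
  obtain ⟨t', h1, h2⟩ := hG
  have hd : torusDist t t' < ((m:ℝ) + 1) / k := by
    unfold torusDist
    rw [Real.sqrt_lt' (by positivity)]
    calc ∑ i, dist (t i) (t' i) ^ 2 ≤ ∑ i : Fin m, (1 / (k:ℝ)) ^ 2 := by
          refine Finset.sum_le_sum fun i _ => ?_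
          refine pow_le_pow_left₀ dist_nonneg ?_ 2
          exact dist_le_of_idx hk (congrFun h1 i).symm
      _ = m * (1 / (k:ℝ)) ^ 2 := by simp
      _ < ((m:ℝ) + 1) ^ 2 * (1 / (k:ℝ)) ^ 2 := by
          have : 0 < (1 / (k:ℝ)) ^ 2 := by positivity
          have hm : (0:ℝ) ≤ m := by positivity
          exact mul_lt_mul_of_pos_right (by nlinarith) this
      _ = _ := by ring
  refine lt_of_le_of_lt ?_ hd
  unfold torusDistSet
  exact ciInf_le ⟨0, by rintro _ ⟨w, rfl⟩; exact Real.sqrt_nonneg _⟩ (⟨t', h2⟩ : (Sᶜ : Set _))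

lemma GG_one {m : ℕ} (S : Set (Torus m)) (hS : S ≠ Set.univ) : GG S 1 = ∅ := by
  rw [Set.eq_empty_iff_forall_notMem]
  intro t ht
  apply hS
  rw [Set.eq_univ_iff_forall]
  intro t'
  apply ht
  ext j
  have h1 := idx_lt le_rfl (t' j)
  have h2 := idx_lt le_rfl (t j)
  simp only [cidx]; omega

lemma GG_meas {m : ℕ} (S : Set (Torus m)) (k : ℕ) : MeasurableSet (GG S k) :=
  cidx_measurable k (Set.to_countable _).measurableSet

lemma whitney {m n : ℕ} (p : ℕ) (F : Fin n → MvPolynomial (Fin m) ℤ)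
    (S : Set (Torus m)) (hS : S ≠ Set.univ) (C a N : ℝ) (hN : 0 ≤ N) (M : ℕ) (err : ℕ → ℝ)
    (h0 : ∀ i, 0 ≤ err i)
    (hshell : ∀ ε : ℝ, 0 < ε → tmeas (innerShell S ε) ≤ C * (a * ε + ε ^ m))
    (he : ∀ i ≤ M, ∀ u : Fin m → ℕ, (∀ j, u j < 2 ^ i) →
      |(Tcount p F (cidx (2 ^ i) ⁻¹' {u}) : ℝ) - N / ((2:ℝ) ^ i) ^ m| ≤ err i) :
    N * tmeas S - N * (C * (a * (((m:ℝ) + 1) / 2 ^ M) + (((m:ℝ) + 1) / 2 ^ M) ^ m))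
      - ∑ i ∈ Finset.range M, C * (a * (((m:ℝ) + 1) / 2 ^ i) + (((m:ℝ) + 1) / 2 ^ i) ^ m)
          * ((2:ℝ) ^ (i + 1)) ^ m * err (i + 1) ≤ Tcount p F S := by
  have key : ∀ L ≤ M, N * volume.real (GG S (2 ^ L)) -
      ∑ i ∈ Finset.range L, C * (a * (((m:ℝ) + 1) / 2 ^ i) + (((m:ℝ) + 1) / 2 ^ i) ^ m)
          * ((2:ℝ) ^ (i + 1)) ^ m * err (i + 1) ≤ Tcount p F (GG S (2 ^ L)) := by
    intro L
    induction L with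
    | zero => intro _; simp [GG_one S hS]
    | succ L ih =>
      intro hL
      have ih := ih (by omega)
      obtain ⟨U, hU⟩ := GG_diff S (2 ^ L)
      have hpow : 2 * 2 ^ L = 2 ^ (L + 1) := by ring
      rw [hpow] at hU
      have hsub := GG_mono S (2 ^ L)
      rw [hpow] at hsub
      have hun : GG S (2 ^ (L + 1)) = GG S (2 ^ L) ∪ (GG S (2 ^ (L + 1)) \ GG S (2 ^ L)) :=
        (Set.union_sdiff_cancel hsub).symm
      have hdis : Disjoint (GG S (2 ^ L)) (GG S (2 ^ (L + 1)) \ GG S (2 ^ L)) :=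
        Set.disjoint_sdiff_right
      have hT := Tcount_union p F hdis
      have hV := measureReal_union (μ := volume) hdis ((GG_meas S _).diff (GG_meas S _))
      rw [← hun] at hT hV
      have hc := cells_set p F (k := 2 ^ (L + 1)) Nat.one_le_two_pow N (err (L + 1))
        (by simpa using he (L + 1) hL) U
      rw [← hU] at hc
      have hsh : volume.real (GG S (2 ^ (L + 1)) \ GG S (2 ^ L)) ≤
          C * (a * (((m:ℝ) + 1) / 2 ^ L) + (((m:ℝ) + 1) / 2 ^ L) ^ m) := by
        refine le_trans ?_ (hshell _ (by positivity))
        refine measureReal_mono ?_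
        have := diff_shell S (k := 2 ^ L) Nat.one_le_two_pow
        push_cast at this
        exact (Set.sdiff_subset_sdiff_left (GG_sub S _)).trans this
      have h3 : volume.real (GG S (2 ^ (L + 1)) \ GG S (2 ^ L)) * ((2:ℝ) ^ (L + 1)) ^ m
          * err (L + 1) ≤ C * (a * (((m:ℝ) + 1) / 2 ^ L) + (((m:ℝ) + 1) / 2 ^ L) ^ m)
          * ((2:ℝ) ^ (L + 1)) ^ m * err (L + 1) := by
        have := h0 (L + 1)
        gcongr
      rw [Finset.sum_range_succ, hT, hV]
      push_cast at hc ⊢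
      linarith
  have h1 := key M le_rfl
  have h2 : (Tcount p F (GG S (2 ^ M)) : ℝ) ≤ Tcount p F S := by
    exact_mod_cast Tcount_mono p F (GG_sub S _)
  have h3 : tmeas S ≤ volume.real (GG S (2 ^ M)) +
      (C * (a * (((m:ℝ) + 1) / 2 ^ M) + (((m:ℝ) + 1) / 2 ^ M) ^ m)) := by
    have hs := hshell (((m:ℝ) + 1) / 2 ^ M) (by positivity)
    have h4 : volume.real S ≤ volume.real (GG S (2 ^ M)) + volume.real (S \ GG S (2 ^ M)) := by
      refine le_trans (measureReal_mono ?_) (measureReal_union_le _ _)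
      rw [Set.union_sdiff_cancel (GG_sub S _)]
    have h5 : volume.real (S \ GG S (2 ^ M)) ≤ tmeas (innerShell S (((m:ℝ) + 1) / 2 ^ M)) := by
      refine measureReal_mono ?_
      have := diff_shell S (k := 2 ^ M) Nat.one_le_two_pow
      push_cast at this
      exact this
    have h6 : tmeas S = volume.real S := rfl
    linarith
  nlinarith [mul_le_mul_of_nonneg_left h3 hN]

lemma geom_bound (q : ℝ) (hq : 2 ≤ q) (M : ℕ) :
    ∑ i ∈ Finset.range M, q ^ (i + 1) ≤ 2 * q ^ M := by
  induction M with
  | zero => simp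
  | succ M ih =>
    rw [Finset.sum_range_succ]
    have : 0 < q ^ M := by positivity
    have h : q ^ (M + 1) = q ^ M * q := pow_succ _ _
    nlinarith

lemma analytic (n d M : ℕ) (hn : 1 ≤ n) (s L a b A C N : ℝ) (hL : 1 ≤ L) (hLs : L ≤ s)
    (ha : 0 ≤ a) (hb : 1 ≤ b) (hA : 0 < A) (hC : 0 ≤ C)
    (hN : s ^ (2 * (n + 1) * (d + 1)) ≤ 2 * N)
    (h1 : (2:ℝ) ^ M ≤ s / L) (h2 : s / L < 2 ^ (M + 1)) (hM : (M:ℝ) ≤ 2 * L) :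
    N * (C * (a * (b / 2 ^ M) + (b / 2 ^ M) ^ (n + 1 + d)))
      + ∑ i ∈ Finset.range M, C * (a * (b / 2 ^ i) + (b / 2 ^ i) ^ (n + 1 + d))
          * ((2:ℝ) ^ (i + 1)) ^ (n + 1 + d) *
          (A * (s ^ ((n + 1) * (d + 1)) * L ^ (n + 1 + d) +
            (((2:ℝ) ^ (i + 1)) ^ d)⁻¹ * s ^ ((n + 1) * (2 * d + 1)) * L ^ (n + 1))) ≤
    C * (2 * b) ^ (n + 1 + d) * (1 + 8 * A) * N * (a * s⁻¹ * L + (s ^ (n + 1))⁻¹ * L ^ (n + 2)) := by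
  have hs : 1 ≤ s := hL.trans hLs
  have hs0 : 0 < s := by linarith
  have hL0 : 0 < L := by linarith
  have hN0 : 0 ≤ N := by
    have : 0 < s ^ (2 * (n + 1) * (d + 1)) := by positivity
    linarith
  set R := s ^ (2 * (n + 1) * (d + 1)) with hR
  set X := s ^ ((n + 1) * (d + 1)) * L ^ (n + 1 + d) with hX
  set Y := s ^ ((n + 1) * (2 * d + 1)) * L ^ (n + 1) with hY
  set w := s⁻¹ * L with hw
  set z := (s ^ (n + 1))⁻¹ * L ^ (n + 2) with hz
  set B := (2 * b) ^ (n + 1 + d) with hB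
  have hX0 : 0 < X := by positivity
  have hY0 : 0 < Y := by positivity
  have hR0 : 0 < R := by positivity
  have hw0 : 0 < w := by positivity
  have hz0 : 0 < z := by positivity
  have hB0 : 0 < B := by positivity
  have hbB : 2 * b ≤ B := le_self_pow₀ (by linarith) (by omega)
  -- the four estimates
  have e1 : X * ((2:ℝ) ^ (n + d)) ^ M ≤ R * w := by
    have : ((2:ℝ) ^ (n + d)) ^ M ≤ (s / L) ^ (n + d) := by
      rw [← pow_mul, mul_comm, pow_mul]; gcongr
    calc X * ((2:ℝ) ^ (n + d)) ^ M ≤ X * (s / L) ^ (n + d) := by gcongr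
      _ = s ^ ((n + 1) * (d + 1) + (n + d) + 1) * w := by
          rw [hX, hw, div_pow, pow_add s _ 1, pow_add s _ (n+d),
            show n + 1 + d = n + d + 1 by ring, pow_succ L (n+d)]
          field_simp
      _ ≤ R * w := by
          rw [hR]
          have : (n + 1) * (d + 1) + (n + d) + 1 ≤ 2 * (n + 1) * (d + 1) := by nlinarith
          gcongr
  have e2 : Y * ((2:ℝ) ^ n) ^ M ≤ R * w := by
    have : ((2:ℝ) ^ n) ^ M ≤ (s / L) ^ n := by
      rw [← pow_mul, mul_comm, pow_mul]; gcongr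
    calc Y * ((2:ℝ) ^ n) ^ M ≤ Y * (s / L) ^ n := by gcongr
      _ = R * w := by
          rw [hY, hw, hR, div_pow, show 2 * (n + 1) * (d + 1) = (n + 1) * (2 * d + 1) + n + 1 by ring,
            pow_add s _ 1, pow_add s _ n, pow_succ L n]
          field_simp
  have e3 : Y * L = R * z := by
    rw [hY, hz, hR, show 2 * (n + 1) * (d + 1) = (n + 1) * (2 * d + 1) + (n + 1) by ring,
      pow_add s _ (n+1), show n + 2 = n + 1 + 1 by ring, pow_succ L (n + 1)]
    field_simp
  have e4 : X * L ≤ R * z := by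
    calc X * L = s ^ ((n + 1) * (d + 1)) * L ^ (n + 2) * L ^ d := by
          rw [hX]; ring
      _ ≤ s ^ ((n + 1) * (d + 1)) * L ^ (n + 2) * s ^ ((n + 1) * d) := by
          have : L ^ d ≤ s ^ ((n + 1) * d) :=
            (pow_le_pow_left₀ hL0.le hLs d).trans (pow_le_pow_right₀ hs (by nlinarith))
          gcongr
      _ = R * z := by
          rw [hR, hz, show 2 * (n + 1) * (d + 1) = (n + 1) * (d + 1) + (n + 1) * d + (n + 1) by ring,
            pow_add s _ (n+1), pow_add s _ ((n+1) * d)]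
          field_simp
  have e5 : 1 / (2:ℝ) ^ M ≤ 2 * w := by
    rw [div_le_iff₀ (by positivity)]
    rw [pow_succ, div_lt_iff₀ hL0] at h2
    rw [hw]
    have : 2 * (s⁻¹ * L) * 2 ^ M = (2 ^ M * 2 * L) / s := by field_simp
    rw [this, le_div_iff₀ hs0]; linarith
  have hmain : a * (b / 2 ^ M) + (b / 2 ^ M) ^ (n + 1 + d) ≤ B * (a * w + z) := by
    have f1 : a * (b / 2 ^ M) ≤ B * (a * w) := by
      calc a * (b / 2 ^ M) = a * b * (1 / 2 ^ M) := by ring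
        _ ≤ a * b * (2 * w) := by gcongr
        _ = (2 * b) * (a * w) := by ring
        _ ≤ _ := by gcongr
    have f2 : (b / 2 ^ M) ^ (n + 1 + d) ≤ B * z := by
      have g1 : (1 / (2:ℝ) ^ M) ^ (n + 1 + d) ≤ (1 / (2:ℝ) ^ M) ^ (n + 1) := by
        apply pow_le_pow_of_le_one (by positivity)
        · rw [div_le_one (by positivity)]; exact one_le_pow₀ (by norm_num)
        · omega
      have g2 : (1 / (2:ℝ) ^ M) ^ (n + 1) ≤ 2 ^ (n + 1) * z := by
        calc (1 / (2:ℝ) ^ M) ^ (n + 1) ≤ (2 * w) ^ (n + 1) := by gcongr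
          _ = 2 ^ (n + 1) * ((s ^ (n + 1))⁻¹ * L ^ (n + 1)) := by
              rw [hw, mul_pow, mul_pow, inv_pow]
          _ ≤ 2 ^ (n + 1) * z := by
              rw [hz]
              have : L ^ (n + 1) ≤ L ^ (n + 2) := pow_le_pow_right₀ hL (by omega)
              gcongr
      calc (b / 2 ^ M) ^ (n + 1 + d) = b ^ (n + 1 + d) * (1 / (2:ℝ) ^ M) ^ (n + 1 + d) := by
            rw [← mul_pow]; congr 1; ring
        _ ≤ b ^ (n + 1 + d) * (2 ^ (n + 1) * z) := by
            have := g1.trans g2; gcongr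
        _ ≤ b ^ (n + 1 + d) * (2 ^ (n + 1 + d) * z) := by
            have : (2:ℝ) ^ (n + 1) ≤ 2 ^ (n + 1 + d) := pow_le_pow_right₀ (by norm_num) (by omega)
            gcongr
        _ = B * z := by rw [hB, mul_pow]; ring
    linarith
  have hsum : ∑ i ∈ Finset.range M, C * (a * (b / 2 ^ i) + (b / 2 ^ i) ^ (n + 1 + d))
          * ((2:ℝ) ^ (i + 1)) ^ (n + 1 + d) *
          (A * (X + (((2:ℝ) ^ (i + 1)) ^ d)⁻¹ * s ^ ((n + 1) * (2 * d + 1)) * L ^ (n + 1)))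
      ≤ ∑ i ∈ Finset.range M, C * B * A * (a * X * ((2:ℝ) ^ (n + d)) ^ (i + 1)
          + a * Y * ((2:ℝ) ^ n) ^ (i + 1) + (X + Y)) := by
    refine Finset.sum_le_sum fun i _ => ?_
    set k := (2:ℝ) ^ (i + 1) with hk
    have hk0 : 0 < k := by positivity
    have hk1 : 1 ≤ k := one_le_pow₀ (by norm_num)
    have hbk : b / 2 ^ i = 2 * b / k := by
      rw [hk, pow_succ]; field_simp
    have t1 : (a * (b / 2 ^ i) + (b / 2 ^ i) ^ (n + 1 + d)) * k ^ (n + 1 + d) ≤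
        B * (a * k ^ (n + d) + 1) := by
      rw [hbk, add_mul, div_pow, div_mul_cancel₀ _ (by positivity), mul_add, mul_one, ← hB]
      have : a * (2 * b / k) * k ^ (n + 1 + d) = (2 * b) * (a * k ^ (n + d)) := by
        rw [show n + 1 + d = n + d + 1 by ring, pow_succ]; field_simp
      rw [this]
      gcongr
    have hpos : 0 ≤ A * (X + (k ^ d)⁻¹ * Y) := by positivity
    have c1 : ((2:ℝ) ^ (n + d)) ^ (i + 1) = k ^ (n + d) := by
      rw [hk, ← pow_mul, ← pow_mul, mul_comm]
    have c2 : ((2:ℝ) ^ n) ^ (i + 1) = k ^ n := by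
      rw [hk, ← pow_mul, ← pow_mul, mul_comm]
    rw [c1, c2, mul_assoc _ (s ^ _) (L ^ _), ← hY]
    calc C * (a * (b / 2 ^ i) + (b / 2 ^ i) ^ (n + 1 + d)) * k ^ (n + 1 + d) *
          (A * (X + (k ^ d)⁻¹ * Y))
        = C * (((a * (b / 2 ^ i) + (b / 2 ^ i) ^ (n + 1 + d)) * k ^ (n + 1 + d)) *
          (A * (X + (k ^ d)⁻¹ * Y))) := by ring
      _ ≤ C * ((B * (a * k ^ (n + d) + 1)) * (A * (X + (k ^ d)⁻¹ * Y))) := by gcongr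
      _ = C * B * A * (a * X * k ^ (n + d) + a * Y * k ^ n + (X + (k ^ d)⁻¹ * Y)) := by
          rw [pow_add k n d]; field_simp
      _ ≤ _ := by
          have : (k ^ d)⁻¹ * Y ≤ Y := by
            apply mul_le_of_le_one_left hY0.le
            exact inv_le_one_of_one_le₀ (one_le_pow₀ hk1)
          gcongr
  have hsum2 : ∑ i ∈ Finset.range M, C * B * A * (a * X * ((2:ℝ) ^ (n + d)) ^ (i + 1)
          + a * Y * ((2:ℝ) ^ n) ^ (i + 1) + (X + Y)) ≤ C * B * A * (4 * (R * (a * w + z))) := by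
    rw [← Finset.mul_sum, Finset.sum_add_distrib, Finset.sum_add_distrib, ← Finset.mul_sum,
      ← Finset.mul_sum, Finset.sum_const, Finset.card_range, nsmul_eq_mul]
    have g1 := geom_bound ((2:ℝ) ^ (n + d)) (le_self_pow₀ (by norm_num) (by omega)) M
    have g2 := geom_bound ((2:ℝ) ^ n) (le_self_pow₀ (by norm_num) (by omega)) M
    have q1 : a * X * ∑ i ∈ Finset.range M, ((2:ℝ) ^ (n + d)) ^ (i + 1) ≤ 2 * (R * (a * w)) := by
      calc _ ≤ a * X * (2 * ((2:ℝ) ^ (n + d)) ^ M) := by gcongr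
        _ = 2 * a * (X * ((2:ℝ) ^ (n + d)) ^ M) := by ring
        _ ≤ 2 * a * (R * w) := by gcongr
        _ = _ := by ring
    have q2 : a * Y * ∑ i ∈ Finset.range M, ((2:ℝ) ^ n) ^ (i + 1) ≤ 2 * (R * (a * w)) := by
      calc _ ≤ a * Y * (2 * ((2:ℝ) ^ n) ^ M) := by gcongr
        _ = 2 * a * (Y * ((2:ℝ) ^ n) ^ M) := by ring
        _ ≤ 2 * a * (R * w) := by gcongr
        _ = _ := by ring
    have q3 : (M:ℝ) * (X + Y) ≤ 4 * (R * z) := by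
      calc (M:ℝ) * (X + Y) ≤ 2 * L * (X + Y) := by gcongr
        _ = 2 * (X * L + Y * L) := by ring
        _ ≤ _ := by linarith
    have : 0 ≤ C * B * A := by positivity
    apply mul_le_mul_of_nonneg_left _ this
    linarith
  have hfin : C * B * A * (4 * (R * (a * w + z))) ≤ C * B * A * (4 * ((2 * N) * (a * w + z))) := by
    gcongr
  have hm2 : N * (C * (a * (b / 2 ^ M) + (b / 2 ^ M) ^ (n + 1 + d))) ≤
      N * (C * (B * (a * w + z))) := by gcongr
  have := hsum.trans (hsum2.trans hfin)
  calc _ ≤ N * (C * (B * (a * w + z))) + C * B * A * (4 * ((2 * N) * (a * w + z))) :=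
        add_le_add hm2 this
    _ = C * B * (1 + 8 * A) * N * (a * w + z) := by ring
    _ = _ := by rw [hw]; ring

/-- Theorem: distribution of solutions of systems of polynomial congruences in
very well shaped sets. Under the Lang–Weil type hypothesis (i) and the Fouvry type
cube-count hypothesis (ii), for every very well shaped `Ω` one has
`|T_p(Ω) − #X_p μ(Ω)| ≤ c #X_p (μ(Ω)^{1−1/m} p^{−1/(2(n+1))} log p + p^{−1/2} (log p)^{n+2})`,
with `c = c(m,n,ν,A,C)`. -/
theorem congruence_solutions_very_well_shaped
    (m n : ℕ) (hn : 1 ≤ n) (hm : n + 1 ≤ m) (ν A C : ℝ) (hν : 1 ≤ ν) (hA : 0 < A) :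
    ∃ c : ℝ, 0 < c ∧
      ∀ p : ℕ, p.Prime →
        ∀ F : Fin n → MvPolynomial (Fin m) ℤ,
          |(((polySolutions p F).ncard : ℝ)) - ν * (p : ℝ) ^ (m - n)|
              ≤ A * (p : ℝ) ^ ((m : ℝ) - n - 1 / 2) →
          (∀ k : ℕ, 1 ≤ k → k ≤ p → ∀ γ : Fin m → ℝ, ∀ u : Fin m → ℤ,
            |((Tcount p F (gridCube γ k u) : ℝ))
                - ((polySolutions p F).ncard : ℝ) / (k : ℝ) ^ m|
              ≤ A * ((p : ℝ) ^ (((m : ℝ) - n) / 2) * Real.log p ^ m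
                  + ((k : ℝ) ^ (m - n - 1))⁻¹ * (p : ℝ) ^ ((m : ℝ) - n - 1 / 2) *
                      Real.log p ^ (n + 1))) →
          ∀ Ω : Set (Torus m), IsVeryWellShaped Ω C →
            |((Tcount p F Ω : ℝ)) - ((polySolutions p F).ncard : ℝ) * tmeas Ω|
              ≤ c * ((polySolutions p F).ncard : ℝ) *
                  (tmeas Ω ^ (1 - 1 / (m : ℝ)) *
                      (p : ℝ) ^ (-(1 / (2 * ((n : ℝ) + 1)))) * Real.log p
                    + (p : ℝ) ^ (-(1 / 2) : ℝ) * Real.log p ^ (n + 2)) := by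
  obtain ⟨d, rfl⟩ : ∃ d, m = n + 1 + d := ⟨m - (n + 1), by omega⟩
  have hev : ∀ᶠ x : ℝ in Filter.atTop, 1 ≤ Real.log x ∧
      Real.log x ≤ x ^ (1 / (2 * ((n : ℝ) + 1))) ∧ 2 * A ≤ x ^ (1 / 2 : ℝ) := by
    have i1 := Real.tendsto_log_atTop.eventually_ge_atTop 1
    have i2 := (isLittleO_log_rpow_atTop
      (show 0 < 1 / (2 * ((n : ℝ) + 1)) by positivity)).bound (c := 1) one_pos
    have i3 := (tendsto_rpow_atTop (show (0:ℝ) < 1 / 2 by norm_num)).eventually_ge_atTop (2 * A)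
    filter_upwards [i1, i2, i3, Filter.eventually_ge_atTop 0] with x h1 h2 h3 h4
    refine ⟨h1, ?_, h3⟩
    rw [one_mul, Real.norm_eq_abs, Real.norm_eq_abs,
      abs_of_nonneg (Real.rpow_nonneg h4 _)] at h2
    exact (le_abs_self _).trans h2
  obtain ⟨P0, hP0⟩ := Filter.eventually_atTop.1 hev
  set P1 := max P0 1 with hP1
  have hP1pos : 0 < P1 := lt_of_lt_of_le one_pos (le_max_right _ _)
  have hlog2 : 0 < Real.log 2 := Real.log_pos (by norm_num)
  set b : ℝ := ((n + 1 + d : ℕ) : ℝ) + 1 with hbdef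
  have hb : 1 ≤ b := by
    have : (0:ℝ) ≤ ((n + 1 + d : ℕ) : ℝ) := Nat.cast_nonneg _
    linarith
  set c1 : ℝ := |C| * (2 * b) ^ (n + 1 + d) * (1 + 8 * A) with hc1
  set c2 : ℝ := P1 ^ (1 / 2 : ℝ) / Real.log 2 ^ (n + 2) with hc2
  have hc1pos : 0 ≤ c1 := by positivity
  have hc2pos : 0 < c2 := by positivity
  refine ⟨c1 + c2, by positivity, ?_⟩
  intro p hp F h1 h2 Ω hΩ
  set N : ℝ := ((polySolutions p F).ncard : ℝ) with hNdef
  have hN0 : 0 ≤ N := Nat.cast_nonneg _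
  have hp2 : (2:ℝ) ≤ p := by exact_mod_cast hp.two_le
  have hp0 : (0:ℝ) < p := by linarith
  have hlogp : Real.log 2 ≤ Real.log p := Real.log_le_log (by norm_num) hp2
  have hlogp0 : 0 < Real.log p := hlog2.trans_le hlogp
  have htm : ∀ S : Set (Torus (n + 1 + d)), 0 ≤ tmeas S := fun S => ENNReal.toReal_nonneg
  have huniv : tmeas (Set.univ : Set (Torus (n + 1 + d))) = 1 := by
    unfold tmeas
    rw [volume_pi, Measure.pi_univ]
    simp
  have htm1 : ∀ S : Set (Torus (n + 1 + d)), tmeas S ≤ 1 := fun S => by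
    rw [← huniv]
    exact measureReal_mono (Set.subset_univ S)
  set a := tmeas Ω ^ (1 - 1 / ((n + 1 + d : ℕ) : ℝ)) with hadef
  have ha : 0 ≤ a := Real.rpow_nonneg (htm _) _
  have hTN : ∀ S, (Tcount p F S : ℝ) ≤ N := fun S => by
    rw [hNdef, ← Tcount_univ p F]
    exact_mod_cast Tcount_mono p F (Set.subset_univ S)
  by_cases hpP : (p:ℝ) < P0
  · -- small primes
    have hz : 1 ≤ c2 * ((p : ℝ) ^ (-(1 / 2) : ℝ) * Real.log p ^ (n + 2)) := by
      have k1 : (p:ℝ) ^ (1 / 2 : ℝ) ≤ P1 ^ (1 / 2 : ℝ) :=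
        Real.rpow_le_rpow hp0.le (hpP.le.trans (le_max_left _ _)) (by norm_num)
      have k2 : Real.log 2 ^ (n + 2) ≤ Real.log p ^ (n + 2) := by gcongr
      have k0 : 0 < (p:ℝ) ^ (1 / 2 : ℝ) := by positivity
      rw [hc2, Real.rpow_neg hp0.le]
      calc (1:ℝ) = ((p:ℝ) ^ (1 / 2 : ℝ) / Real.log 2 ^ (n + 2)) *
            (((p:ℝ) ^ (1 / 2 : ℝ))⁻¹ * Real.log 2 ^ (n + 2)) := by field_simp
        _ ≤ _ := by gcongr
    have hT0 : (0:ℝ) ≤ Tcount p F Ω := Nat.cast_nonneg _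
    have hab : |((Tcount p F Ω : ℝ)) - N * tmeas Ω| ≤ N := by
      have := mul_nonneg hN0 (htm Ω)
      have := mul_le_mul_of_nonneg_left (htm1 Ω) hN0
      have := hTN Ω
      rw [abs_le]; constructor <;> linarith
    refine hab.trans ?_
    calc N = N * 1 := by ring
      _ ≤ N * (c2 * ((p : ℝ) ^ (-(1 / 2) : ℝ) * Real.log p ^ (n + 2))) := by gcongr
      _ = (0 + c2) * N * (0 + (p : ℝ) ^ (-(1 / 2) : ℝ) * Real.log p ^ (n + 2)) := by ring
      _ ≤ _ := by
        have : 0 ≤ a * (p : ℝ) ^ (-(1 / (2 * ((n : ℝ) + 1)))) * Real.log p := by positivity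
        gcongr
  -- large primes
  push Not at hpP
  obtain ⟨hL1, hLs, hAp⟩ := hP0 p hpP
  set L := Real.log p with hLdef
  set s := (p:ℝ) ^ (1 / (2 * ((n : ℝ) + 1))) with hsdef
  have hs0 : 0 < s := by positivity
  have hs1 : 1 ≤ s := hL1.trans hLs
  have conv : ∀ (k : ℕ) (r : ℝ), r * (2 * ((n:ℝ) + 1)) = k → (p:ℝ) ^ r = s ^ k := by
    intro k r hr
    rw [hsdef, ← Real.rpow_mul_natCast hp0.le, ← hr]
    congr 1
    field_simp
  have hR : (p:ℝ) ^ (n + 1 + d - n) = s ^ (2 * (n + 1) * (d + 1)) := by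
    rw [← Real.rpow_natCast, show n + 1 + d - n = d + 1 by omega]
    apply conv; push_cast; ring
  have hY : (p:ℝ) ^ (((n + 1 + d : ℕ) : ℝ) - n - 1 / 2) = s ^ ((n + 1) * (2 * d + 1)) := by
    apply conv; push_cast; ring
  have hX : (p:ℝ) ^ ((((n + 1 + d : ℕ) : ℝ) - n) / 2) = s ^ ((n + 1) * (d + 1)) := by
    apply conv; push_cast; ring
  have hhalf : (p:ℝ) ^ (1 / 2 : ℝ) = s ^ (n + 1) := by
    apply conv; push_cast; ring
  rw [hR, hY] at h1
  rw [Real.rpow_neg hp0.le, Real.rpow_neg hp0.le, hhalf, ← hsdef]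
  have hNR : s ^ (2 * (n + 1) * (d + 1)) ≤ 2 * N := by
    have k1 := (abs_le.1 h1).1
    rw [hhalf] at hAp
    have k2 : s ^ (2 * (n + 1) * (d + 1)) = s ^ ((n + 1) * (2 * d + 1)) * s ^ (n + 1) := by
      rw [← pow_add]; congr 1; ring
    have k3 : 0 < s ^ ((n + 1) * (2 * d + 1)) := by positivity
    have k4 : 2 * A * s ^ ((n + 1) * (2 * d + 1)) ≤ s ^ (2 * (n + 1) * (d + 1)) := by
      rw [k2, mul_comm]; gcongr
    have k5 : s ^ (2 * (n + 1) * (d + 1)) ≤ ν * s ^ (2 * (n + 1) * (d + 1)) :=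
      le_mul_of_one_le_left (by positivity) hν
    linarith
  have hQ : 1 ≤ s / L := by rw [one_le_div hlogp0]; exact hLs
  obtain ⟨M, hM1, hM2⟩ := exists_nat_pow_near hQ (show (1:ℝ) < 2 by norm_num)
  have hQp : s / L ≤ p := by
    have k1 : s / L ≤ s := div_le_self hs0.le hL1
    have k2 : (p:ℝ) = s ^ (2 * (n + 1)) := by
      rw [← conv (2 * (n + 1)) 1 (by push_cast; ring), Real.rpow_one]
    have k3 : s ≤ s ^ (2 * (n + 1)) := le_self_pow₀ hs1 (by omega)
    linarith
  have hMp : (2:ℝ) ^ M ≤ p := hM1.trans hQp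
  have hML : (M:ℝ) ≤ 2 * L := by
    have k1 := Real.log_le_log (by positivity) hMp
    rw [Real.log_pow] at k1
    have k2 := Real.log_two_gt_d9
    have k3 : (0:ℝ) ≤ M := Nat.cast_nonneg _
    rw [← hLdef] at k1
    nlinarith
  have han := analytic n d M hn s L a b A |C| N hL1 hLs ha hb hA (abs_nonneg C) hNR hM1 hM2 hML
  have hwhit : ∀ S : Set (Torus (n + 1 + d)), S ≠ Set.univ →
      (∀ ε : ℝ, 0 < ε → tmeas (innerShell S ε) ≤ C * (a * ε + ε ^ (n + 1 + d))) →
      N * tmeas S - c1 * N * (a * s⁻¹ * L + (s ^ (n + 1))⁻¹ * L ^ (n + 2)) ≤ Tcount p F S := by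
    intro S hS hsh
    have hw := whitney p F S hS |C| a N hN0 M
      (fun i => A * (s ^ ((n + 1) * (d + 1)) * L ^ (n + 1 + d) +
            (((2:ℝ) ^ i) ^ d)⁻¹ * s ^ ((n + 1) * (2 * d + 1)) * L ^ (n + 1)))
      (fun i => by positivity)
      (fun ε hε => (hsh ε hε).trans (by
        have := le_abs_self C
        gcongr))
      (by
        intro i hi u hu
        have hip : 2 ^ i ≤ p := by
          have : (2:ℝ) ^ i ≤ p := (pow_le_pow_right₀ (by norm_num) hi).trans hMp
          exact_mod_cast this
        have := h2 (2 ^ i) Nat.one_le_two_pow hip (fun _ => Real.sqrt 2) (fun j => (u j : ℤ))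
        rw [← cidx_count p F Nat.one_le_two_pow hu, hX, hY,
          show n + 1 + d - n - 1 = d by omega] at this
        push_cast at this
        exact this)
    rw [← hbdef] at hw
    linarith
  have hRHS : 0 ≤ N * (a * s⁻¹ * L + (s ^ (n + 1))⁻¹ * L ^ (n + 2)) := by positivity
  have hRHS2 : 0 ≤ c2 * N * (a * s⁻¹ * L + (s ^ (n + 1))⁻¹ * L ^ (n + 2)) := by positivity
  have hRHS3 : 0 ≤ (c1 + c2) * N * (a * s⁻¹ * L + (s ^ (n + 1))⁻¹ * L ^ (n + 2)) := by positivity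
  by_cases hU : Ω = Set.univ
  · have e1 : (Tcount p F Ω : ℝ) - N * tmeas Ω = 0 := by
      rw [hU, huniv, Tcount_univ, ← hNdef]; ring
    rw [e1, abs_zero]; exact hRHS3
  by_cases hE : Ω = ∅
  · have e1 : (Tcount p F Ω : ℝ) - N * tmeas Ω = 0 := by
      rw [hE]; simp [Tcount, tmeas]
    rw [e1, abs_zero]; exact hRHS3
  have w1 := hwhit Ω hU (fun ε hε => (hΩ ε hε).2)
  have w2 := hwhit Ωᶜ (by simpa [Set.compl_univ_iff] using hE) (fun ε hε => by
    have : innerShell Ωᶜ ε = outerShell Ω ε := by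
      unfold innerShell outerShell
      rw [compl_compl]; rfl
    rw [this]
    exact (hΩ ε hε).1)
  have hTc : (Tcount p F Ω : ℝ) + Tcount p F Ωᶜ = N := by
    rw [hNdef, ← Tcount_univ p F, ← Set.union_compl_self Ω,
      Tcount_union p F disjoint_compl_right]
    push_cast; rfl
  have hmc : 1 ≤ tmeas Ω + tmeas Ωᶜ := by
    rw [← huniv, ← Set.union_compl_self Ω]
    exact measureReal_union_le _ _
  have hNm := mul_le_mul_of_nonneg_left hmc hN0
  rw [abs_le]
  constructor <;> linarith
end

section
/- Discrepancy bound over cubes of integer points: let p be a prime, let m, n be positive integers, and let G_1, …, G_n ∈ F_p[X_1, …, X_m] be degree 2 independent over F_p with total degrees at most d. Then there is a constant c depending only on m, n and d such that for all integers u and w with 1 ≤ w < p, the discrepancy of the (w+1)^m points ({G_1(x)/p}, …, {G_n(x)/p}) ∈ 𝕋_n, as x ranges over the integer vectors x ∈ {u, u+1, …, u+w}^m, is at most c · p^{1/2} w^{−1} (log p)^{n+1}. -/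
open MeasureTheory

section AuxPoly
open Polynomial

lemma step_notdvd {L : Type*} [Field L] {p : ℕ} (hp : 2 ≤ p)
    (hsurj : ∀ c : L, ∃ γ, γ ^ p = c) (f : L[X]) (hD : 0 < f.natDegree)
    {ι : Type*} (s : Finset ι) (a : ι → L) (α β : ι → ℕ)
    (hw : ∀ i ∈ s, ∀ j ∈ s, p * α i + f.natDegree * β i = p * α j + f.natDegree * β j → i = j)
    (ha : ∃ i ∈ s, a i ≠ 0) :
    ¬ ((X ^ p - X - C f : L[X][X]) ∣ ∑ i ∈ s, C (C (a i) * X ^ (α i)) * X ^ (β i)) := by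
  rintro ⟨S, hS⟩
  set D := f.natDegree with hDdef
  let Φ : L[X][X] →+* L[X][X] :=
    eval₂RingHom (eval₂RingHom ((C : L[X] →+* L[X][X]).comp (C : L →+* L[X])) (X ^ p)) (C X * X ^ D)
  have hC : ∀ h : L[X], Φ (C h) = expand L[X] p (h.map C) := by
    intro h
    have h1 : Φ (C h) = eval₂ ((C : L[X] →+* L[X][X]).comp (C : L →+* L[X])) (X ^ p) h := by
      simp [Φ]
    rw [h1, expand_eq_sum, ← eval₂_map, eval₂_eq_sum]
  have hX : Φ X = C X * X ^ D := by simp [Φ]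
  have hg : Φ (X ^ p - X - C f) = C (X ^ p) * X ^ (D * p) - C X * X ^ D - expand L[X] p (f.map C) := by
    rw [map_sub, map_sub, map_pow, hX, hC, mul_pow, ← C_pow, ← pow_mul]
  have hP : Φ (∑ i ∈ s, C (C (a i) * X ^ (α i)) * X ^ (β i)) =
      ∑ i ∈ s, C (C (a i) * X ^ β i) * X ^ (p * α i + D * β i) := by
    rw [map_sum]
    refine Finset.sum_congr rfl fun i _ => ?_
    rw [map_mul, hC, map_pow, hX]
    simp only [Polynomial.map_mul, Polynomial.map_pow, map_C, map_X, map_mul, map_pow, expand_C, expand_X]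
    ring
  have hDp : D < D * p := by nlinarith
  have hcoef : (Φ (X ^ p - X - C f)).coeff (D * p) = X ^ p - C f.leadingCoeff := by
    rw [hg, coeff_sub, coeff_sub, coeff_C_mul_X_pow, coeff_C_mul_X_pow,
      coeff_expand_mul (by omega)]
    rw [coeff_map, if_pos rfl, if_neg hDp.ne', sub_zero, hDdef, coeff_natDegree]
  have hc0 : (X ^ p - C f.leadingCoeff : L[X]) ≠ 0 := by
    exact X_pow_sub_C_ne_zero (by omega) _
  have hdeg : (Φ (X ^ p - X - C f)).natDegree = D * p := by
    apply le_antisymm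
    · rw [hg]
      refine (natDegree_sub_le _ _).trans (max_le ((natDegree_sub_le _ _).trans (max_le ?_ ?_)) ?_)
      · exact natDegree_C_mul_X_pow_le _ _
      · exact (natDegree_C_mul_X_pow_le _ _).trans hDp.le
      · rw [natDegree_expand, natDegree_map]
    · exact le_natDegree_of_ne_zero (by rw [hcoef]; exact hc0)
  have hcoefP : ∀ i ∈ s, (Φ (∑ i ∈ s, C (C (a i) * X ^ (α i)) * X ^ (β i))).coeff
      (p * α i + D * β i) = C (a i) * X ^ β i := by
    intro i hi
    rw [hP, finsetSum_coeff, Finset.sum_eq_single i]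
    · rw [coeff_C_mul_X_pow, if_pos rfl]
    · intro j hj hji
      rw [coeff_C_mul_X_pow, if_neg]
      intro h; exact hji (hw j hj i hi h.symm)
    · intro h; exact absurd hi h
  set P := Φ (∑ i ∈ s, C (C (a i) * X ^ (α i)) * X ^ (β i)) with hPdef
  have hP0 : P ≠ 0 := by
    obtain ⟨i, hi, hai⟩ := ha
    intro h
    have := hcoefP i hi
    rw [h, coeff_zero] at this
    exact (mul_ne_zero (C_ne_zero.2 hai) (pow_ne_zero _ X_ne_zero)) this.symm
  have hlead : ∃ i ∈ s, a i ≠ 0 ∧ P.leadingCoeff = C (a i) * X ^ β i := by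
    have h1 : P.coeff P.natDegree ≠ 0 := leadingCoeff_ne_zero.2 hP0
    have h2 : ∃ i ∈ s, p * α i + D * β i = P.natDegree := by
      by_contra hcon
      push Not at hcon
      apply h1
      have h3 : P.coeff P.natDegree = (∑ i ∈ s, C (C (a i) * X ^ β i) * X ^ (p * α i + D * β i)).coeff P.natDegree :=
        congrArg (fun z => coeff z P.natDegree) hP
      rw [h3, finsetSum_coeff]
      refine Finset.sum_eq_zero fun i hi => ?_
      rw [coeff_C_mul_X_pow, if_neg (Ne.symm (hcon i hi))]
    obtain ⟨i, hi, h⟩ := h2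
    refine ⟨i, hi, ?_, ?_⟩
    · intro h0
      apply h1
      rw [← h, hcoefP i hi, h0]; simp
    · rw [leadingCoeff, ← h, hcoefP i hi]
  obtain ⟨i, hi, hai, hl⟩ := hlead
  have hmul : P.leadingCoeff = (X ^ p - C f.leadingCoeff) * (Φ S).leadingCoeff := by
    rw [hPdef, hS, map_mul, leadingCoeff_mul]
    congr 1
    rw [leadingCoeff, hdeg, hcoef]
  obtain ⟨γ, hγ⟩ := hsurj f.leadingCoeff
  have hf0 : f.leadingCoeff ≠ 0 := leadingCoeff_ne_zero.2 (by rintro rfl; simp at hDdef; omega)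
  have hγ0 : γ ≠ 0 := by
    rintro rfl; rw [zero_pow (by omega)] at hγ; exact hf0 hγ.symm
  rw [hl] at hmul
  have := congrArg (eval γ) hmul
  simp only [eval_mul, eval_C, eval_pow, eval_X, eval_sub, hγ, sub_self, zero_mul] at this
  exact (mul_ne_zero hai (pow_ne_zero _ hγ0)) this

lemma step_red {L : Type*} [Field L] {p : ℕ} (hp : 2 ≤ p) (f : L[X]) (e : ℕ) :
    ∃ h : L[X][X], (X ^ p - X - C f : L[X][X]) ∣ (X ^ e - h) ∧
      ∀ i j, (h.coeff j).coeff i ≠ 0 → j < p ∧ p * i + f.natDegree * j ≤ f.natDegree * e := by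
  induction e with
  | zero =>
    refine ⟨1, by simp, ?_⟩
    intro i j h
    rw [coeff_one] at h
    split_ifs at h with hj
    · subst hj
      rw [coeff_one] at h
      split_ifs at h with hi
      · subst hi; simp; omega
      · simp at h
    · simp at h
  | succ e ih =>
    obtain ⟨h, hd, hc⟩ := ih
    let t := h.coeff (p - 1)
    refine ⟨X * h - C t * (X ^ p - X - C f), ?_, ?_⟩
    · have : (X ^ (e+1) - (X * h - C t * (X ^ p - X - C f)) : L[X][X])
        = X * (X ^ e - h) + C t * (X ^ p - X - C f) := by ring
      rw [this]
      exact dvd_add (Dvd.dvd.mul_left hd _) (Dvd.intro_left _ rfl)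
    · intro i j hne
      set D := f.natDegree
      rcases j with _ | j
      · -- coefficient zero
        have h0 : (X * h - C t * (X ^ p - X - C f)).coeff 0 = t * f := by
          have : (0:ℕ) ≠ p := by omega
          simp [coeff_X_pow, this]
        rw [h0] at hne
        rw [coeff_mul] at hne
        obtain ⟨⟨x, y⟩, hxy, hne⟩ := Finset.exists_ne_zero_of_sum_ne_zero hne
        replace hxy : x + y = i := Finset.HasAntidiagonal.mem_antidiagonal.1 hxy
        replace hne : t.coeff x * f.coeff y ≠ 0 := hne
        have h1 := hc x (p - 1) (left_ne_zero_of_mul hne)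
        have h2 : y ≤ D := le_natDegree_of_ne_zero (right_ne_zero_of_mul hne)
        refine ⟨by omega, ?_⟩
        have h3 := h1.2
        obtain ⟨q, rfl⟩ : ∃ q, p = q + 1 := ⟨p - 1, by omega⟩
        simp only [Nat.add_sub_cancel] at h3
        subst hxy
        nlinarith
      · have h0 : (X * h - C t * (X ^ p - X - C f)).coeff (j + 1)
            = h.coeff j - t * ((if j + 1 = p then 1 else 0) - (if j = 0 then 1 else 0)) := by
          rw [coeff_sub, coeff_X_mul, coeff_C_mul, coeff_sub, coeff_sub, coeff_X_pow, coeff_X, coeff_C]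
          simp [eq_comm]
        rw [h0] at hne
        by_cases hjp : j + 1 = p
        · exfalso
          apply hne
          have : j ≠ 0 := by omega
          have ht : t = h.coeff j := by simp only [t]; congr 1; omega
          simp [hjp, this, ht]
        · rw [if_neg hjp] at hne
          by_cases hj0 : j = 0
          · subst hj0
            simp only [if_true, zero_sub, mul_neg, mul_one, sub_neg_eq_add, coeff_add] at hne
            by_cases h1 : (h.coeff 0).coeff i = 0
            · rw [h1, zero_add] at hne
              have h3 := hc _ _ hne
              refine ⟨by omega, ?_⟩
              have h4 := h3.2
              obtain ⟨q, rfl⟩ : ∃ q, p = q + 1 := ⟨p - 1, by omega⟩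
              simp only [Nat.add_sub_cancel] at h4
              nlinarith
            · have h3 := hc _ _ h1
              refine ⟨by omega, ?_⟩
              nlinarith [h3.2]
          · simp only [if_neg hj0, sub_self, mul_zero, sub_zero] at hne
            have h3 := hc _ _ hne
            refine ⟨by omega, ?_⟩
            nlinarith [h3.2]

lemma step_inj {p D Q i j k l i' j' k' l' : ℕ} (hp : p.Prime) (hD : ¬ p ∣ D)
    (hj : j < p) (hj' : j' < p) (hl : l < p) (hl' : l' < p)
    (h1 : p * k + D * l < Q) (h1' : p * k' + D * l' < Q)
    (h : p * (i * Q + k) + D * (j * Q + l) = p * (i' * Q + k') + D * (j' * Q + l')) :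
    i = i' ∧ j = j' ∧ k = k' ∧ l = l' := by
  have key : ∀ {i j i' j' : ℕ}, j < p → j' < p → p * i + D * j = p * i' + D * j' → i = i' ∧ j = j' := by
    intro i j i' j' hj hj' h
    have h2 : (D * j) ≡ (D * j') [MOD p] := by
      have : (p * i + D * j) % p = (p * i' + D * j') % p := by rw [h]
      simpa [Nat.ModEq, Nat.add_mod] using this
    have hc : Nat.gcd p D = 1 := (Nat.Prime.coprime_iff_not_dvd hp).2 hD
    have h3 := Nat.ModEq.cancel_left_of_coprime hc h2
    have h4 : j = j' := Nat.ModEq.eq_of_lt_of_lt h3 hj hj'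
    subst h4
    exact ⟨Nat.eq_of_mul_eq_mul_left hp.pos (by omega), rfl⟩
  have e1 : (p * k + D * l) + Q * (p * i + D * j) = (p * k' + D * l') + Q * (p * i' + D * j') := by
    linarith
  have e2 := congrArg (· % Q) e1
  have e3 := congrArg (· / Q) e1
  have hQ : 0 < Q := by omega
  simp only [Nat.add_mul_mod_self_left, Nat.mod_eq_of_lt h1, Nat.mod_eq_of_lt h1'] at e2
  simp only [Nat.add_mul_div_left _ _ hQ, Nat.div_eq_of_lt h1, Nat.div_eq_of_lt h1', zero_add] at e3
  obtain ⟨a, b⟩ := key hl hl' e2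
  obtain ⟨c, d⟩ := key hj hj' e3
  exact ⟨c, d, a, b⟩

lemma step_main {L : Type*} [Field L] [IsAlgClosed L] {p : ℕ} [hp : Fact p.Prime] [CharP L p]
    (f : L[X]) (hD : ¬ p ∣ f.natDegree) (r s Q : ℕ) (hs : s = p ^ r) (hQ : Q = p * s)
    (hbig : p * (f.natDegree + 2) * f.natDegree + 2 * f.natDegree + 3 < s)
    (B : Finset L) (hB : ∀ x ∈ B, x ^ (Q ^ 2) = x ∧ ∃ y, y ^ (Q ^ 2) = y ∧ y ^ p - y = f.eval x) :
    B.card ≤ p * s ^ 2 + (2 * f.natDegree + 3) * (p * s) := by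
  classical
  have hp2 : 2 ≤ p := hp.out.two_le
  have hQp : Q = p ^ (r + 1) := by rw [hQ, hs, pow_succ']
  have hsurj : ∀ c : L, ∃ γ, γ ^ p = c := fun c => IsAlgClosed.exists_pow_nat_eq c (by omega)
  have hsurjQ : ∀ c : L, ∃ γ, γ ^ Q = c :=
    fun c => IsAlgClosed.exists_pow_nat_eq c (by rw [hQp]; positivity)
  choose h hdvd hco using step_red hp2 f
  set D := f.natDegree with hDdef
  have hDpos : 0 < D := Nat.pos_of_ne_zero (by rintro h0; rw [h0] at hD; simp at hD)
  obtain ⟨K, hK⟩ : ∃ K, s = K + D := ⟨s - D, by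
    have : 0 ≤ p * (D + 2) * D := Nat.zero_le _
    omega⟩
  let I := s + D + 2
  let N := K * Q + I + D * (Q + 1)
  let N' := I * Q + K + D * (Q + 1)
  let ι := Fin I × Fin p × Fin K × Fin p
  -- reduction degree bound
  have hred : ∀ (M a e : ℕ), e ≤ p * (Q + 1) → a ≤ M → ∀ i j,
      ((C (X ^ a) * h e).coeff j).coeff i ≠ 0 → j < p ∧ i ≤ M + D * (Q + 1) := by
    intro M a e he ha i j hne
    rw [coeff_C_mul, coeff_X_pow_mul'] at hne
    split_ifs at hne with hai
    · have := hco e _ _ hne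
      refine ⟨this.1, ?_⟩
      have h2 : p * (i - a) ≤ p * (D * (Q + 1)) := by nlinarith [this.2]
      have h3 := Nat.le_of_mul_le_mul_left h2 (by omega)
      omega
    · exact absurd rfl hne
  have he : ∀ j l : Fin p, (l : ℕ) * Q + j ≤ p * (Q + 1) := by
    intro j l
    have := j.2; have := l.2
    nlinarith
  let v : ι → (Fin p × Fin (N + 1) → L) := fun t z =>
    ((C (X ^ ((t.2.2.1 : ℕ) * Q + t.1)) * h ((t.2.2.2 : ℕ) * Q + t.2.1)).coeff z.1).coeff z.2
  have hker : LinearMap.ker (Fintype.linearCombination L v) ≠ ⊥ := by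
    apply LinearMap.ker_ne_bot_of_finrank_lt
    simp only [Module.finrank_fintype_fun_eq_card, Fintype.card_prod, Fintype.card_fin, ι]
    have : N + 1 < I * (K * p) := by
      simp only [N, I]
      rw [hQ]
      subst hK
      nlinarith
    calc p * (N + 1) < p * (I * (K * p)) := Nat.mul_lt_mul_of_pos_left this (by omega)
      _ = I * (p * (K * p)) := by ring
  obtain ⟨b, hbk, hb0⟩ := (Submodule.ne_bot_iff _).1 hker
  have hbsum : ∑ t, C (C (b t)) * (C (X ^ ((t.2.2.1 : ℕ) * Q + t.1)) * h ((t.2.2.2 : ℕ) * Q + t.2.1)) = 0 := by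
    ext j i
    simp only [finsetSum_coeff, coeff_C_mul, coeff_zero]
    by_cases hji : j < p ∧ i ≤ N
    · have := congrFun (LinearMap.mem_ker.1 hbk) (⟨j, hji.1⟩, ⟨i, by omega⟩)
      rw [Fintype.linearCombination_apply, Finset.sum_apply] at this
      simpa only [v, coeff_C_mul, Pi.smul_apply, smul_eq_mul, Pi.zero_apply] using this
    · refine Finset.sum_eq_zero fun t _ => ?_
      by_contra hne
      have h1 := right_ne_zero_of_mul hne
      rw [← coeff_C_mul] at h1
      have hk := t.2.2.1.2; have hi := t.1.2
      have := hred (K * Q + I) _ _ (he t.2.1 t.2.2.2) (by nlinarith) i j h1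
      exact hji this
  choose a ha using fun t => hsurjQ (b t)
  let H : L[X][X] := ∑ t : ι, C (C (a t)) * (C (X ^ ((t.1 : ℕ) * Q + t.2.2.1)) * h ((t.2.1 : ℕ) * Q + t.2.2.2))
  have hHco : ∀ i j, (H.coeff j).coeff i ≠ 0 → j < p ∧ i ≤ N' := by
    intro i j hne
    simp only [H, finsetSum_coeff] at hne
    obtain ⟨t, _, hne⟩ := Finset.exists_ne_zero_of_sum_ne_zero hne
    rw [coeff_C_mul, coeff_C_mul] at hne
    have h1 := right_ne_zero_of_mul hne
    have hk := t.2.2.1.2; have hi := t.1.2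
    exact hred (I * Q + K) _ _ (he t.2.2.2 t.2.1) (by nlinarith) i j h1
  have hH0 : H ≠ 0 := by
    intro hH
    apply step_notdvd hp2 hsurj f (by omega) (Finset.univ : Finset ι) a
      (fun t => (t.1 : ℕ) * Q + t.2.2.1) (fun t => (t.2.1 : ℕ) * Q + t.2.2.2)
    · have hlt : ∀ t : ι, p * (t.2.2.1 : ℕ) + D * (t.2.2.2 : ℕ) < Q := by
        intro t
        have h1 : (t.2.2.1 : ℕ) + 1 ≤ K := t.2.2.1.2
        have h2 := t.2.2.2.2
        rw [hQ, hK]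
        nlinarith
      rintro t - t' - heq
      obtain ⟨e1, e2, e3, e4⟩ := step_inj hp.out hD t.2.1.2 t'.2.1.2 t.2.2.2.2 t'.2.2.2.2 (hlt t) (hlt t') heq
      ext <;> assumption
    · by_contra hcon
      push Not at hcon
      apply hb0
      ext t
      rw [← ha t, hcon t (Finset.mem_univ _), zero_pow (by rw [hQp]; positivity)]
      rfl
    · have : ∑ t : ι, C (C (a t) * X ^ ((t.1 : ℕ) * Q + t.2.2.1)) * X ^ ((t.2.1 : ℕ) * Q + t.2.2.2)
        = ∑ t : ι, C (C (a t) * X ^ ((t.1 : ℕ) * Q + t.2.2.1)) *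
            (X ^ ((t.2.1 : ℕ) * Q + t.2.2.2) - h ((t.2.1 : ℕ) * Q + t.2.2.2)) + H := by
        simp only [H]
        rw [← Finset.sum_add_distrib]
        refine Finset.sum_congr rfl fun t _ => ?_
        rw [C_mul]; ring
      rw [this, hH, add_zero]
      exact Finset.dvd_sum fun t _ => Dvd.dvd.mul_left (hdvd _) _
  -- vanishing at points
  have hev : ∀ x y : L, y ^ p - y = f.eval x → ∀ e, evalEval x y (h e) = y ^ e := by
    intro x y hxy e
    obtain ⟨S, hS⟩ := hdvd e
    have := congrArg (evalEvalRingHom x y) hS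
    simp only [map_sub, map_mul, map_pow] at this
    simp only [coe_evalEvalRingHom, evalEval_X, evalEval_C, hxy, sub_self, zero_mul] at this
    exact (sub_eq_zero.1 this).symm
  have hvan : ∀ x y : L, x ^ (Q ^ 2) = x → y ^ (Q ^ 2) = y → y ^ p - y = f.eval x →
      evalEval x y H = 0 := by
    intro x y hx hy hxy
    have h1 := congrArg (evalEvalRingHom x y) hbsum
    simp only [map_sum, map_mul, map_zero] at h1
    simp only [coe_evalEvalRingHom, evalEval_C, eval_C, eval_pow, eval_X, hev x y hxy] at h1
    have h2 : evalEval x y H = ∑ t : ι, a t * (x ^ ((t.1 : ℕ) * Q + t.2.2.1) * y ^ ((t.2.1 : ℕ) * Q + t.2.2.2)) := by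
      change evalEvalRingHom x y H = _
      simp only [H, map_sum, map_mul]
      simp only [coe_evalEvalRingHom, evalEval_C, eval_C, eval_pow, eval_X, hev x y hxy]
    have h3 : (evalEval x y H) ^ Q = 0 := by
      rw [h2, hQp, sum_pow_char_pow, ← hQp, ← h1]
      refine Finset.sum_congr rfl fun t _ => ?_
      rw [mul_pow, mul_pow, ha t, ← pow_mul, ← pow_mul]
      congr 2
      · rw [show ((t.1 : ℕ) * Q + t.2.2.1) * Q = Q ^ 2 * t.1 + t.2.2.1 * Q by ring, pow_add, pow_mul, hx,
          ← pow_add, add_comm]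
      · rw [show ((t.2.1 : ℕ) * Q + t.2.2.2) * Q = Q ^ 2 * t.2.1 + t.2.2.2 * Q by ring, pow_add, pow_mul, hy,
          ← pow_add, add_comm]
    exact pow_eq_zero_iff (by rw [hQp]; positivity) |>.1 h3
  obtain ⟨j0, hj0⟩ : ∃ j, H.coeff j ≠ 0 := by
    by_contra hcon
    push Not at hcon
    exact hH0 (Polynomial.ext (by simpa using hcon))
  have hroot : ∀ x ∈ B, (H.coeff j0).IsRoot x := by
    intro x hx
    obtain ⟨hxq, y, hyq, hxy⟩ := hB x hx
    let Hx : L[X] := H.map (evalRingHom x)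
    have hdegx : Hx.degree < p := by
      rw [degree_lt_iff_coeff_zero]
      intro m hm
      simp only [Hx, coeff_map]
      have : H.coeff m = 0 := by
        ext i
        by_contra hne
        exact absurd (hHco i m hne).1 (by omega)
      rw [this, map_zero]
    let Y : Finset L := Finset.univ.image (fun t : ZMod p => y + ZMod.castHom (dvd_refl p) L t)
    have hYc : Y.card = p := by
      rw [Finset.card_image_of_injective, Finset.card_univ, ZMod.card]
      exact (add_right_injective y).comp (RingHom.injective _)
    have hHx : Hx = 0 := by
      refine Polynomial.eq_zero_of_degree_lt_of_eval_finset_eq_zero Y (by rw [hYc]; exact hdegx) ?_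
      intro z hz
      obtain ⟨t, -, rfl⟩ := Finset.mem_image.1 hz
      set τ := ZMod.castHom (dvd_refl p) L t with hτ
      have hτp : τ ^ p = τ := by rw [hτ, ← map_pow, ZMod.pow_card]
      have hτq : τ ^ (Q ^ 2) = τ := by
        rw [hQp, ← pow_mul, hτ, ← map_pow, ZMod.pow_card_pow]
      have := hvan x (y + τ) hxq
        (by rw [hQp, ← pow_mul, add_pow_char_pow, pow_mul, ← hQp, hyq, hτq])
        (by rw [add_pow_char, hτp, ← hxy]; ring)
      rw [evalEval, ] at this
      rw [← this]
      simp only [Hx]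
      rw [map_evalRingHom_eval]
    have := congrArg (fun z => coeff z j0) hHx
    simpa [Hx] using this
  have hcard : B.card ≤ (H.coeff j0).natDegree := by
    have hsub : B ⊆ (H.coeff j0).roots.toFinset := by
      intro x hx
      rw [Multiset.mem_toFinset, mem_roots hj0]
      exact hroot x hx
    exact (Finset.card_le_card hsub).trans ((Multiset.toFinset_card_le _).trans (card_roots' _))
  have hle : (H.coeff j0).natDegree ≤ N' :=
    (hHco _ j0 (by rw [coeff_natDegree]; exact leadingCoeff_ne_zero.2 hj0)).2
  refine hcard.trans (hle.trans ?_)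
  simp only [N', I]
  rw [hQ]
  have : K + D = s := hK.symm
  nlinarith

section
variable {L : Type*} [Field L] [IsAlgClosed L] {p : ℕ} [hp : Fact p.Prime] [CharP L p]
  [Algebra (ZMod p) L]

noncomputable def FqS (L : Type*) [Field L] (p k : ℕ) : Finset L :=
  open Classical in (X ^ (p ^ k) - X : L[X]).roots.toFinset

lemma mem_FqS {k : ℕ} (hk : k ≠ 0) {x : L} : x ∈ FqS L p k ↔ x ^ (p ^ k) = x := by
  classical
  rw [FqS, Multiset.mem_toFinset, mem_roots (FiniteField.X_pow_card_pow_sub_X_ne_zero L hk hp.out.one_lt)]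
  simp [sub_eq_zero]

lemma card_FqS {k : ℕ} (hk : k ≠ 0) : (FqS L p k).card = p ^ k := by
  classical
  rw [FqS, Multiset.toFinset_card_of_nodup, IsAlgClosed.card_roots_eq_natDegree,
    FiniteField.X_pow_card_pow_sub_X_natDegree_eq L hk hp.out.one_lt]
  exact nodup_roots (galois_poly_separable p _ (dvd_pow_self p hk))

lemma exists_zmod_of_pow {τ : L} (h : τ ^ p = τ) : ∃ t : ZMod p, algebraMap (ZMod p) L t = τ := by
  have h1 : τ ∈ FqS L p 1 := by rw [mem_FqS one_ne_zero]; simpa using h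
  have h2 : Finset.univ.map ⟨algebraMap (ZMod p) L, (algebraMap (ZMod p) L).injective⟩ = FqS L p 1 := by
    apply Finset.eq_of_subset_of_card_le
    · intro x hx
      obtain ⟨t, -, rfl⟩ := Finset.mem_map.1 hx
      rw [mem_FqS one_ne_zero]
      simp only [Function.Embedding.coeFn_mk]
      rw [← map_pow, pow_one, ZMod.pow_card]
    · rw [card_FqS one_ne_zero, Finset.card_map, Finset.card_univ, ZMod.card, pow_one]
  rw [← h2] at h1
  obtain ⟨t, -, rfl⟩ := Finset.mem_map.1 h1
  exact ⟨t, rfl⟩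

lemma eval_frob (f : (ZMod p)[X]) (x : L) (i : ℕ) :
    (f.map (algebraMap (ZMod p) L)).eval (x ^ p ^ i) = ((f.map (algebraMap (ZMod p) L)).eval x) ^ p ^ i := by
  rw [eval_map, eval_map]
  have := hom_eval₂ f (algebraMap (ZMod p) L) (iterateFrobenius L p i) x
  rw [iterateFrobenius_def, iterateFrobenius_def] at this
  rw [this]
  congr 1
  exact Subsingleton.elim _ _

lemma exists_trace (k : ℕ) (t : ZMod p) : ∃ c : L, ∑ i ∈ Finset.range (k + 1), c ^ p ^ i = algebraMap (ZMod p) L t := by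
  let P : L[X] := X ^ p ^ k + (∑ i ∈ Finset.range k, X ^ p ^ i - C (algebraMap (ZMod p) L t))
  have hdeg : P.degree ≠ 0 := by
    have h1 : (∑ i ∈ Finset.range k, X ^ p ^ i - C (algebraMap (ZMod p) L t) : L[X]).degree < (X ^ p ^ k : L[X]).degree := by
      rw [degree_X_pow]
      have hpos : 0 < p ^ k := pow_pos hp.out.pos _
      refine lt_of_le_of_lt (degree_sub_le _ _) (max_lt ?_ ?_)
      · refine lt_of_le_of_lt (degree_sum_le _ _) ?_
        rw [Finset.sup_lt_iff]
        · intro i hi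
          rw [degree_X_pow]
          exact_mod_cast Nat.pow_lt_pow_right hp.out.one_lt (Finset.mem_range.1 hi)
        · exact WithBot.bot_lt_coe _
      · exact lt_of_le_of_lt degree_C_le (by exact_mod_cast hpos)
    simp only [P]
    rw [degree_add_eq_left_of_degree_lt h1, degree_X_pow]
    have : p ^ k ≠ 0 := pow_ne_zero _ hp.out.ne_zero
    exact_mod_cast this
  obtain ⟨c, hc⟩ := IsAlgClosed.exists_root P hdeg
  refine ⟨c, ?_⟩
  rw [Finset.sum_range_succ]
  simp only [P, IsRoot.def, eval_add, eval_sub, eval_pow, eval_X, eval_C, eval_finsetSum] at hc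
  linear_combination hc

lemma trace_pow (k : ℕ) (c : L) : (∑ i ∈ Finset.range k, c ^ p ^ i) ^ p - ∑ i ∈ Finset.range k, c ^ p ^ i
    = c ^ p ^ k - c := by
  rw [sum_pow_char]
  simp_rw [← pow_mul, ← pow_succ]
  rw [← Finset.sum_sub_distrib, Finset.sum_range_sub (fun i => c ^ p ^ i)]
  simp

lemma trace_AS (k : ℕ) (y : L) : (∑ i ∈ Finset.range k, (y ^ p - y) ^ p ^ i) = y ^ p ^ k - y := by
  simp_rw [sub_pow_char_pow, ← pow_mul, ← pow_succ']
  rw [Finset.sum_range_sub (fun i => y ^ p ^ i)]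
  simp

lemma count_trace (f : (ZMod p)[X]) (hD : ¬ p ∣ f.natDegree) (r : ℕ)
    (hbig : p * (f.natDegree + 2) * f.natDegree + 2 * f.natDegree + 3 < p ^ r) (t : ZMod p)
    (B : Finset L) (hB : ∀ x ∈ B, x ^ (p ^ (2 * (r + 1))) = x ∧
      ∑ i ∈ Finset.range (2 * (r + 1)), ((f.map (algebraMap (ZMod p) L)).eval x) ^ p ^ i = algebraMap (ZMod p) L t) :
    B.card ≤ p * (p ^ r) ^ 2 + (2 * f.natDegree + 3) * (p * p ^ r) := by
  obtain ⟨c, hc⟩ := exists_trace (L := L) (2 * r + 1) t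
  rw [show 2 * r + 1 + 1 = 2 * (r + 1) by ring] at hc
  have hdeg : (f.map (algebraMap (ZMod p) L) - C c).natDegree = f.natDegree := by
    rw [natDegree_sub_C, natDegree_map]
  have hcq : c ^ p ^ (2 * (r + 1)) = c := by
    have := trace_pow (2 * (r + 1)) c
    rw [hc, ← map_pow, ZMod.pow_card, sub_self] at this
    exact (sub_eq_zero.1 this.symm)
  have hQ : (p * p ^ r) ^ 2 = p ^ (2 * (r + 1)) := by rw [← pow_succ', ← pow_mul]; ring_nf
  have := step_main (f.map (algebraMap (ZMod p) L) - C c) (by rwa [hdeg]) r (p ^ r) (p * p ^ r) rfl rfl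
    (by rwa [hdeg]) B ?_
  · rwa [hdeg] at this
  · intro x hx
    rw [hQ]
    obtain ⟨hxq, hxt⟩ := hB x hx
    refine ⟨hxq, ?_⟩
    set z := (f.map (algebraMap (ZMod p) L) - C c).eval x with hz
    have hz' : z = (f.map (algebraMap (ZMod p) L)).eval x - c := by simp [hz]
    obtain ⟨y, hy⟩ := IsAlgClosed.exists_root (X ^ p - X - C z : L[X]) (by
      have : (X ^ p - X - C z : L[X]).natDegree = p := by
        rw [natDegree_sub_C, FiniteField.X_pow_card_sub_X_natDegree_eq L hp.out.one_lt]
      intro h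
      have h2 := natDegree_eq_of_degree_eq_some h
      rw [this] at h2
      exact hp.out.ne_zero h2)
    have hy' : y ^ p - y = z := by
      simp at hy
      linear_combination hy
    refine ⟨y, ?_, hy'⟩
    have h1 := trace_AS (2 * (r + 1)) y
    rw [hy', hz'] at h1
    simp_rw [sub_pow_char_pow] at h1
    rw [Finset.sum_sub_distrib, hxt, hc, sub_self] at h1
    exact sub_eq_zero.1 h1.symm

/-- The extension sums. -/
noncomputable def Ssum (Ψ : AddChar L ℂ) (f : (ZMod p)[X]) (k : ℕ) : ℂ :=
  ∑ x ∈ FqS L p k, Ψ (∑ i ∈ Finset.range k, (f.map (algebraMap (ZMod p) L)).eval (x ^ p ^ i))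

lemma Ssum_bound (Ψ : AddChar L ℂ) (hΨ : ∃ t : ZMod p, Ψ (algebraMap (ZMod p) L t) ≠ 1)
    (f : (ZMod p)[X]) (hD : ¬ p ∣ f.natDegree) (r : ℕ)
    (hbig : p * (f.natDegree + 2) * f.natDegree + 2 * f.natDegree + 3 < p ^ r) :
    ‖Ssum Ψ f (2 * (r + 1))‖ ≤ (2 * p * (2 * f.natDegree + 3)) * (p : ℝ) ^ (r + 1) := by
  classical
  set k := 2 * (r + 1) with hk
  have hk0 : k ≠ 0 := by omega
  set φ := algebraMap (ZMod p) L with hφ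
  let ψ : AddChar (ZMod p) ℂ := Ψ.compAddMonoidHom φ.toAddMonoidHom
  have hψ : ∀ t, ψ t = Ψ (φ t) := fun t => rfl
  have hψ1 : ψ ≠ 1 := by
    obtain ⟨t, ht⟩ := hΨ
    intro h
    apply ht
    rw [← hψ, h]; rfl
  let tr : L → L := fun x => ∑ i ∈ Finset.range k, (f.map φ).eval (x ^ p ^ i)
  have htr : ∀ x, tr x = ∑ i ∈ Finset.range k, ((f.map φ).eval x) ^ p ^ i := by
    intro x
    exact Finset.sum_congr rfl fun i _ => eval_frob f x i
  have htr2 : ∀ x ∈ FqS L p k, ∃ t, φ t = tr x := by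
    intro x hx
    apply exists_zmod_of_pow
    rw [mem_FqS hk0] at hx
    rw [htr, ← sub_eq_zero, trace_pow, ← eval_frob, hx, sub_self]
  choose! τ hτ using htr2
  let N : ZMod p → Finset L := fun t => (FqS L p k).filter (fun x => τ x = t)
  have hN : ∀ t, (N t).card ≤ p * (p ^ r) ^ 2 + (2 * f.natDegree + 3) * (p * p ^ r) := by
    intro t
    apply count_trace f hD r hbig t
    intro x hx
    obtain ⟨hx1, hx2⟩ := Finset.mem_filter.1 hx
    refine ⟨(mem_FqS hk0).1 hx1, ?_⟩
    rw [← htr, ← hτ x hx1, hx2]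
  have hsumN : ∑ t, (N t).card = p ^ k := by
    rw [← card_FqS (L := L) hk0]
    exact (Finset.card_eq_sum_card_fiberwise (fun x _ => Finset.mem_univ _)).symm
  have hS : Ssum Ψ f k = ∑ t, ((N t).card : ℂ) * ψ t := by
    rw [Ssum, ← Finset.sum_fiberwise_of_maps_to (t := Finset.univ) (g := τ) (fun x _ => Finset.mem_univ _)]
    refine Finset.sum_congr rfl fun t _ => ?_
    rw [Finset.sum_congr rfl (g := fun _ => ψ t), Finset.sum_const, nsmul_eq_mul]
    intro x hx
    obtain ⟨hx1, hx2⟩ := Finset.mem_filter.1 hx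
    rw [hψ, ← hx2, hτ x hx1]
  have hp0 : (0 : ℝ) < p := by exact_mod_cast hp.out.pos
  let A : ℝ := p * ((p : ℝ) ^ r) ^ 2
  let E : ℝ := (2 * f.natDegree + 3) * (p * p ^ r)
  have hE : 0 ≤ E := by positivity
  have hNr : ∀ t, ((N t).card : ℝ) ≤ A + E := by
    intro t
    have := hN t
    simp only [A, E]
    exact_mod_cast this
  have hsumNr : ∑ t, (((N t).card : ℝ) - A) = 0 := by
    rw [Finset.sum_sub_distrib, Finset.sum_const, Finset.card_univ, ZMod.card, ← Nat.cast_sum, hsumN]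
    simp only [A, hk]
    push_cast
    rw [nsmul_eq_mul]
    ring
  have hS2 : Ssum Ψ f k = ∑ t, (((N t).card : ℂ) - A) * ψ t := by
    simp_rw [sub_mul]
    rw [Finset.sum_sub_distrib, ← hS, ← Finset.mul_sum, AddChar.sum_eq_zero_of_ne_one hψ1]
    simp
  rw [hS2]
  calc ‖∑ t, (((N t).card : ℂ) - A) * ψ t‖ ≤ ∑ t, |((N t).card : ℝ) - A| := by
        refine norm_sum_le_of_le _ fun t _ => ?_
        rw [norm_mul, AddChar.norm_apply, mul_one]
        rw [← Complex.ofReal_natCast, ← Complex.ofReal_sub, Complex.norm_real, Real.norm_eq_abs]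
    _ ≤ ∑ t : ZMod p, (2 * E - (((N t).card : ℝ) - A)) := by
        refine Finset.sum_le_sum fun t _ => ?_
        have := hNr t
        rw [abs_le]; constructor <;> linarith
    _ = 2 * p * E := by
        rw [Finset.sum_sub_distrib, hsumNr, Finset.sum_const, Finset.card_univ, ZMod.card, nsmul_eq_mul]
        ring
    _ = _ := by simp only [E]; ring
end

lemma newton_multiset {K : Type*} [Field K] (R : Multiset K) (k : ℕ) :
    (k : K) * ((-1) ^ k * R.esymm k) +
      ∑ i ∈ Finset.range k, ((-1) ^ i * R.esymm i) * (R.map (· ^ (k - i))).sum = 0 := by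
  obtain ⟨l, rfl⟩ := Quot.exists_rep R
  have hl : (Quot.mk _ l : Multiset K) = (Finset.univ : Finset (Fin l.length)).val.map l.get := by
    change (l : Multiset K) = _
    rw [Fin.univ_val_map, List.ofFn_get]
  rw [hl]
  set a := l.get
  have h := congrArg (MvPolynomial.aeval (R := K) a) (MvPolynomial.mul_esymm_eq_sum (Fin l.length) K k)
  have hps : ∀ j, MvPolynomial.aeval (R := K) a (MvPolynomial.psum (Fin l.length) K j) =
      (((Finset.univ : Finset (Fin l.length)).val.map a).map (· ^ j)).sum := by
    intro j
    rw [MvPolynomial.psum, map_sum, Multiset.map_map]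
    simp [Finset.sum]
  have hsum : ∑ i ∈ Finset.range k, ((-1) ^ i * ((Finset.univ : Finset (Fin l.length)).val.map a).esymm i) *
      (((Finset.univ : Finset (Fin l.length)).val.map a).map (· ^ (k - i))).sum =
      ∑ z ∈ (Finset.HasAntidiagonal.antidiagonal k).filter (fun z => z.1 < k),
      ((-1) ^ z.1 * ((Finset.univ : Finset (Fin l.length)).val.map a).esymm z.1) *
      (((Finset.univ : Finset (Fin l.length)).val.map a).map (· ^ z.2)).sum := by
    symm
    refine Finset.sum_bij' (fun z _ => z.1) (fun i _ => (i, k - i)) ?_ ?_ ?_ ?_ ?_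
    · intro z hz; simp at hz ⊢; exact hz.2
    · intro i hi; simp at hi ⊢; omega
    · intro z hz; simp at hz ⊢; ext <;> simp; omega
    · intro i hi; rfl
    · intro z hz
      simp at hz
      rw [show k - z.1 = z.2 by omega]
  simp only [map_mul, map_sum, map_natCast, map_pow, map_neg, map_one,
    MvPolynomial.aeval_esymm_eq_multiset_esymm, hps] at h
  rw [hsum]
  rw [← mul_assoc, mul_comm (k : K), mul_assoc, h, ← mul_assoc, ← pow_add,
    show k + (k + 1) = 2 * k + 1 by ring, pow_succ, pow_mul]
  simp

/-- two sequences obeying Newton identities -/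
lemma newton_compare {K : Type*} [CommRing K] {c c' s s' : ℕ → K} (h0 : c 0 = 1) (h0' : c' 0 = 1)
    (h : ∀ k : ℕ, (k : K) * c k + ∑ i ∈ Finset.range k, c i * s (k - i) = 0)
    (h' : ∀ k : ℕ, (k : K) * c' k + ∑ i ∈ Finset.range k, c' i * s' (k - i) = 0)
    (D : ℕ) (hc : ∀ i < D, c i = c' i) :
    (∀ j, 1 ≤ j → j < D → s j = s' j) ∧ (1 ≤ D → s' D = s D - D * (c' D - c D)) := by
  have hs : ∀ j, 1 ≤ j → j < D → s j = s' j := by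
    intro j
    induction j using Nat.strong_induction_on with
    | _ j ih =>
      intro hj1 hjD
      obtain ⟨j, rfl⟩ : ∃ i, j = i + 1 := ⟨j - 1, by omega⟩
      have e := h (j + 1)
      have e' := h' (j + 1)
      rw [Finset.sum_range_succ'] at e e'
      have : ∑ i ∈ Finset.range j, c (i + 1) * s (j + 1 - (i + 1)) =
          ∑ i ∈ Finset.range j, c' (i + 1) * s' (j + 1 - (i + 1)) := by
        refine Finset.sum_congr rfl fun i hi => ?_
        have := Finset.mem_range.1 hi
        rw [hc (i + 1) (by omega), ih (j + 1 - (i + 1)) (by omega) (by omega) (by omega)]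
      rw [this, h0, hc (j + 1) hjD] at e
      rw [h0'] at e'
      simp only [Nat.sub_zero, one_mul] at e e'
      linear_combination e - e'
  refine ⟨hs, fun hD => ?_⟩
  obtain ⟨j, rfl⟩ : ∃ i, D = i + 1 := ⟨D - 1, by omega⟩
  have e := h (j + 1)
  have e' := h' (j + 1)
  rw [Finset.sum_range_succ'] at e e'
  have : ∑ i ∈ Finset.range j, c (i + 1) * s (j + 1 - (i + 1)) =
      ∑ i ∈ Finset.range j, c' (i + 1) * s' (j + 1 - (i + 1)) := by
    refine Finset.sum_congr rfl fun i hi => ?_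
    have := Finset.mem_range.1 hi
    rw [hc (i + 1) (by omega), hs (j + 1 - (i + 1)) (by omega) (by omega)]
  rw [this, h0] at e
  rw [h0'] at e'
  simp only [Nat.sub_zero, one_mul] at e e'
  linear_combination e' - e

section
variable {L : Type*} [Field L] [IsAlgClosed L] {p : ℕ} [hp : Fact p.Prime] [CharP L p]
  [Algebra (ZMod p) L]

lemma monSet_finite (p n : ℕ) [Fact p.Prime] : {g : (ZMod p)[X] | g.Monic ∧ g.natDegree = n}.Finite := by
  refine (Set.finite_range (fun a : Fin n → ZMod p => (X ^ n + ∑ i, C (a i) * X ^ (i : ℕ) : (ZMod p)[X]))).subset ?_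
  rintro g ⟨hg, hn⟩
  refine ⟨fun i => g.coeff i, ?_⟩
  conv_rhs => rw [hg.as_sum, hn]
  simp only
  rw [Fin.sum_univ_eq_sum_range (fun i => C (g.coeff i) * X ^ i)]

noncomputable def Mon (p n : ℕ) [Fact p.Prime] : Finset (ZMod p)[X] := (monSet_finite p n).toFinset

lemma mem_Mon {n : ℕ} {g : (ZMod p)[X]} : g ∈ Mon p n ↔ g.Monic ∧ g.natDegree = n := by
  simp [Mon]

lemma Mon_zero : Mon p 0 = {1} := by
  ext g
  rw [mem_Mon, Finset.mem_singleton]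
  constructor
  · rintro ⟨h1, h2⟩; exact h1.natDegree_eq_zero.1 h2
  · rintro rfl; simp

noncomputable def rts (L : Type*) [Field L] {p : ℕ} [Algebra (ZMod p) L] (g : (ZMod p)[X]) : Multiset L :=
  (g.map (algebraMap (ZMod p) L)).roots

noncomputable def chi (Ψ : AddChar L ℂ) (f g : (ZMod p)[X]) : ℂ :=
  Ψ (((rts L g).map (fun α => (f.map (algebraMap (ZMod p) L)).eval α)).sum)

lemma rts_mul {g h : (ZMod p)[X]} (hg : g.Monic) (hh : h.Monic) : rts L (g * h) = rts L g + rts L h := by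
  rw [rts, Polynomial.map_mul, roots_mul]
  · rfl
  · exact ((hg.map _).mul (hh.map _)).ne_zero

lemma chi_mul (Ψ : AddChar L ℂ) (f : (ZMod p)[X]) {g h : (ZMod p)[X]} (hg : g.Monic) (hh : h.Monic) :
    chi Ψ f (g * h) = chi Ψ f g * chi Ψ f h := by
  rw [chi, rts_mul hg hh, Multiset.map_add, Multiset.sum_add, AddChar.map_add_eq_mul]
  rfl

lemma card_rts {g : (ZMod p)[X]} : (rts L g).card = g.natDegree := by
  rw [rts, IsAlgClosed.card_roots_eq_natDegree, natDegree_map]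

noncomputable def csum (Ψ : AddChar L ℂ) (f : (ZMod p)[X]) (n : ℕ) : ℂ := ∑ g ∈ Mon p n, chi Ψ f g

lemma csum_zero (Ψ : AddChar L ℂ) (f : (ZMod p)[X]) : csum Ψ f 0 = 1 := by
  rw [csum, Mon_zero, Finset.sum_singleton, chi, rts]
  simp

lemma esymm_rts {n : ℕ} {g : (ZMod p)[X]} (hg : g.Monic) (hn : g.natDegree = n) {i : ℕ} (hi : i ≤ n) :
    (-1) ^ i * (rts L g).esymm i = algebraMap (ZMod p) L (g.coeff (n - i)) := by
  have hnd : (g.map (algebraMap (ZMod p) L)).natDegree = n := by rw [natDegree_map, hn]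
  have := coeff_eq_esymm_roots_of_card (p := g.map (algebraMap (ZMod p) L))
    (IsAlgClosed.card_roots_eq_natDegree) (k := n - i) (by rw [hnd]; omega)
  rw [hnd, (hg.map _).leadingCoeff, one_mul, show n - (n - i) = i by omega, coeff_map] at this
  rw [this]; rfl

lemma sum_eval_multiset {K : Type*} [Field K] (f : K[X]) (R : Multiset K) :
    (R.map (fun α => f.eval α)).sum = ∑ j ∈ Finset.range (f.natDegree + 1), f.coeff j * (R.map (· ^ j)).sum := by
  induction R using Multiset.induction_on with
  | empty => simp
  | cons a R ih =>
    simp only [Multiset.map_cons, Multiset.sum_cons, ih, mul_add, Finset.sum_add_distrib]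
    rw [eval_eq_sum_range]

lemma csum_eq_zero (Ψ : AddChar L ℂ) (hΨ : ∃ t : ZMod p, Ψ (algebraMap (ZMod p) L t) ≠ 1)
    (f : (ZMod p)[X]) (hD : ¬ p ∣ f.natDegree) {n : ℕ} (hn : f.natDegree ≤ n) : csum Ψ f n = 0 := by
  set D := f.natDegree with hDdef
  have hD0 : 1 ≤ D := Nat.pos_of_ne_zero (by rintro h0; rw [h0] at hD; simp at hD)
  obtain ⟨t, ht⟩ := hΨ
  have hDp : (D : ZMod p) ≠ 0 := by rwa [Ne, ZMod.natCast_eq_zero_iff]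
  have hf0 : f.leadingCoeff ≠ 0 := leadingCoeff_ne_zero.2 (by rintro rfl; simp at hDdef; omega)
  set δ : ZMod p := -t / (D * f.leadingCoeff) with hδ
  have key : ∀ g ∈ Mon p n, g + C δ * X ^ (n - D) ∈ Mon p n ∧
      chi Ψ f (g + C δ * X ^ (n - D)) = chi Ψ f g * Ψ (algebraMap (ZMod p) L t) := by
    intro g hg
    obtain ⟨hgm, hgn⟩ := mem_Mon.1 hg
    have hlt : (C δ * X ^ (n - D)).degree < g.degree := by
      rw [degree_eq_natDegree hgm.ne_zero, hgn]
      refine lt_of_le_of_lt (degree_C_mul_X_pow_le _ _) ?_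
      exact_mod_cast (by omega)
    have hgm' : (g + C δ * X ^ (n - D)).Monic := hgm.add_of_left hlt
    have hgn' : (g + C δ * X ^ (n - D)).natDegree = n := by
      rw [natDegree_add_eq_left_of_degree_lt hlt, hgn]
    refine ⟨mem_Mon.2 ⟨hgm', hgn'⟩, ?_⟩
    set g' := g + C δ * X ^ (n - D) with hg'
    have hcmp := newton_compare (c := fun i => (-1) ^ i * (rts L g).esymm i)
      (c' := fun i => (-1) ^ i * (rts L g').esymm i)
      (s := fun j => ((rts L g).map (· ^ j)).sum) (s' := fun j => ((rts L g').map (· ^ j)).sum)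
      (by simp [Multiset.esymm]) (by simp [Multiset.esymm]) (newton_multiset _) (newton_multiset _) D (by
        intro i hi
        rw [esymm_rts hgm hgn (by omega), esymm_rts hgm' hgn' (by omega), hg', coeff_add, coeff_C_mul_X_pow,
          if_neg (by omega), add_zero])
    obtain ⟨h1, h2⟩ := hcmp
    have h2 := h2 hD0
    simp only at h1 h2
    rw [esymm_rts hgm hgn hn, esymm_rts hgm' hgn' hn, hg', coeff_add, coeff_C_mul_X_pow, if_pos rfl,
      map_add, add_sub_cancel_left, ← hg'] at h2
    have h3 : ((rts L g').map (fun α => (f.map (algebraMap (ZMod p) L)).eval α)).sum =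
        ((rts L g).map (fun α => (f.map (algebraMap (ZMod p) L)).eval α)).sum + algebraMap (ZMod p) L t := by
      rw [sum_eval_multiset, sum_eval_multiset, natDegree_map, ← hDdef, Finset.sum_range_succ,
        Finset.sum_range_succ, h2]
      have h4 : ∑ j ∈ Finset.range D, (f.map (algebraMap (ZMod p) L)).coeff j * ((rts L g').map (· ^ j)).sum
        = ∑ j ∈ Finset.range D, (f.map (algebraMap (ZMod p) L)).coeff j * ((rts L g).map (· ^ j)).sum := by
        refine Finset.sum_congr rfl fun j hj => ?_
        rcases Nat.eq_zero_or_pos j with rfl | hj0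
        · simp [card_rts, hgn, hgn']
        · rw [h1 j hj0 (Finset.mem_range.1 hj)]
      have h5 : algebraMap (ZMod p) L t = - ((f.map (algebraMap (ZMod p) L)).coeff D * (D * algebraMap (ZMod p) L δ)) := by
        rw [coeff_map, ← map_natCast (algebraMap (ZMod p) L), ← map_mul, ← map_mul, ← map_neg]
        congr 1
        have h6 : f.coeff D = f.leadingCoeff := rfl
        rw [hδ, h6]
        field_simp
      rw [h4, h5]
      ring
    rw [chi, h3, AddChar.map_add_eq_mul]
    rfl
  have h1 : csum Ψ f n = csum Ψ f n * Ψ (algebraMap (ZMod p) L t) := by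
    conv_rhs => rw [csum, Finset.sum_mul]
    have hinj : Set.InjOn (fun g : (ZMod p)[X] => g + C δ * X ^ (n - D)) (Mon p n) :=
      fun a _ b _ h => add_right_cancel h
    have himg : (Mon p n).image (fun g : (ZMod p)[X] => g + C δ * X ^ (n - D)) = Mon p n := by
      apply Finset.eq_of_subset_of_card_le
      · intro x hx
        obtain ⟨g, hg, rfl⟩ := Finset.mem_image.1 hx
        exact (key g hg).1
      · rw [Finset.card_image_of_injOn hinj]
    rw [csum]
    conv_lhs => rw [← himg]
    rw [Finset.sum_image hinj]
    exact Finset.sum_congr rfl fun g hg => (key g hg).2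
  have h2 : csum Ψ f n * (1 - Ψ (algebraMap (ZMod p) L t)) = 0 := by linear_combination h1
  rcases mul_eq_zero.1 h2 with h | h
  · exact h
  · exact absurd (sub_eq_zero.1 h).symm ht
end

section
variable {L : Type*} [Field L] [IsAlgClosed L] {p : ℕ} [hp : Fact p.Prime] [CharP L p]
  [Algebra (ZMod p) L]

noncomputable def orb {L : Type*} [Field L] (p k : ℕ) (x : L) : Multiset L :=
  (Multiset.range k).map (fun i => x ^ p ^ i)

lemma card_orb (k : ℕ) (x : L) : (orb p k x).card = k := by simp [orb]

lemma mul_expchar_frob (a : ZMod p) : (algebraMap (ZMod p) L a) ^ p = algebraMap (ZMod p) L a := by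
  rw [← map_pow, ZMod.pow_card]

lemma prod_orb_map_frob {k : ℕ} {x : L} (hx : x ^ p ^ k = x) :
    (∏ i ∈ Finset.range k, (X - C (x ^ p ^ i))).map (frobenius L p) =
    ∏ i ∈ Finset.range k, (X - C (x ^ p ^ i)) := by
  rw [Polynomial.map_prod]
  have h1 : ∀ i, Polynomial.map (frobenius L p) (X - C (x ^ p ^ i)) = X - C (x ^ p ^ (i + 1)) := by
    intro i
    rw [Polynomial.map_sub, map_X, map_C, frobenius_def, ← pow_mul, ← pow_succ]
  simp only [h1]
  cases k with
  | zero => simp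
  | succ k =>
    rw [Finset.prod_range_succ, hx, Finset.prod_range_succ' (fun i => X - C (x ^ p ^ i))]
    simp

lemma cp_exists {k : ℕ} {x : L} (hx : x ^ p ^ k = x) :
    ∃ g ∈ Mon p k, rts L g = orb p k x := by
  set P : L[X] := ∏ i ∈ Finset.range k, (X - C (x ^ p ^ i)) with hP
  have hPm : P.Monic := monic_prod_of_monic _ _ fun i _ => monic_X_sub_C _
  have hPd : P.natDegree = k := by
    rw [hP, natDegree_prod_of_monic _ _ fun i _ => monic_X_sub_C _]
    simp only [natDegree_X_sub_C]
    simp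
  have hlift : P ∈ lifts (algebraMap (ZMod p) L) := by
    rw [lifts_iff_coeff_lifts]
    intro n
    have := congrArg (fun q : L[X] => q.coeff n) (prod_orb_map_frob hx)
    simp only [coeff_map, frobenius_def] at this
    obtain ⟨t, ht⟩ := exists_zmod_of_pow (p := p) this
    exact ⟨t, ht⟩
  obtain ⟨g, hg⟩ := (mem_lifts P).1 hlift
  have hinj : Function.Injective (algebraMap (ZMod p) L) := (algebraMap (ZMod p) L).injective
  refine ⟨g, mem_Mon.2 ⟨?_, ?_⟩, ?_⟩
  · exact monic_of_injective hinj (hg ▸ hPm)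
  · rw [← hPd, ← hg, natDegree_map]
  · rw [rts, hg, hP]
    have := roots_multiset_prod_X_sub_C (orb p k x)
    rw [← this, orb, Multiset.map_map]
    rfl

lemma rts_frob (g : (ZMod p)[X]) : (rts L g).map (· ^ p) = rts L g := by
  have h := (IsAlgClosed.splits (g.map (algebraMap (ZMod p) L))).roots_map (frobenius L p)
  rw [Polynomial.map_map] at h
  have h2 : (frobenius L p).comp (algebraMap (ZMod p) L) = algebraMap (ZMod p) L := by
    ext a; simp [frobenius_def, ← map_pow, ZMod.pow_card]
  rw [h2] at h
  exact h.symm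

lemma dvd_of_rts_le {g h : (ZMod p)[X]} (hg : g.Monic) (hh : h.Monic) (hle : rts L h ≤ rts L g) : h ∣ g := by
  rw [← map_dvd_map' (algebraMap (ZMod p) L)]
  have : h.map (algebraMap (ZMod p) L) = ((rts L h).map fun a => X - C a).prod :=
    (IsAlgClosed.splits _).eq_prod_roots_of_monic (hh.map _)
  rw [this]
  exact (Multiset.prod_X_sub_C_dvd_iff_le_roots (hg.map _).ne_zero _).2 hle

lemma orb_mul {d : ℕ} {x : L} (hx : x ^ p ^ d = x) (e : ℕ) : orb p (d * e) x = e • orb p d x := by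
  have hper : ∀ e i : ℕ, x ^ p ^ (d * e + i) = x ^ p ^ i := by
    intro e
    induction e with
    | zero => simp
    | succ e ih =>
      intro i
      rw [show d * (e + 1) + i = d + (d * e + i) by ring, pow_add, pow_mul, hx, ih]
  induction e with
  | zero => simp [orb]
  | succ e ih =>
    rw [succ_nsmul, ← ih, mul_add, mul_one, orb, Multiset.range_add, Multiset.map_add]
    congr 1
    rw [Multiset.map_map, orb]
    exact Multiset.map_congr rfl fun i _ => hper e i

lemma frob_iter (i : ℕ) (x : L) : (fun y : L => y ^ p)^[i] x = x ^ p ^ i := by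
  rw [pow_iterate]

lemma count_orb_stable [DecidableEq L] {M : Multiset L} (hM : M.map (· ^ p) = M) (x : L) (i : ℕ) :
    M.count (x ^ p ^ i) = M.count x := by
  have hinj : Function.Injective (fun y : L => y ^ p) := frobenius_inj L p
  induction i with
  | zero => simp
  | succ i ih =>
    rw [← ih, pow_succ, pow_mul]
    conv_lhs => rw [← hM]
    exact Multiset.count_map_eq_count' _ _ hinj _

lemma orbit_count [DecidableEq L] {M : Multiset L} (hM : M.map (· ^ p) = M) {x : L} (hx : x ∈ M) :
    ((Finset.Icc 1 M.card).filter (fun k => x ^ p ^ k = x ∧ orb p k x ≤ M)).card = M.count x := by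
  classical
  have hinj : Function.Injective (fun y : L => y ^ p) := frobenius_inj L p
  set d := Function.minimalPeriod (fun y : L => y ^ p) x with hd
  have hper : ∀ k, x ^ p ^ k = x ↔ d ∣ k := by
    intro k
    rw [hd, ← Function.isPeriodicPt_iff_minimalPeriod_dvd, Function.IsPeriodicPt, Function.IsFixedPt, frob_iter]
  have hcx : 0 < M.count x := Multiset.count_pos.2 hx
  have hd0 : 0 < d := by
    -- pigeonhole
    have hmem : ∀ i : ℕ, x ^ p ^ i ∈ M.toFinset := by
      intro i
      rw [Multiset.mem_toFinset, ← Multiset.count_pos, count_orb_stable hM]; exact hcx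
    obtain ⟨i, -, j, -, hij, he⟩ := Set.infinite_univ.exists_ne_map_eq_of_mapsTo
      (f := fun i : ℕ => x ^ p ^ i) (t := (M.toFinset : Set L)) (fun i _ => hmem i) (Finset.finite_toSet _)
    have aux : ∀ i j : ℕ, i < j → x ^ p ^ i = x ^ p ^ j → 0 < d := by
      intro i j hij he
      have : x ^ p ^ (j - i) = x := by
        apply hinj.iterate i
        simp only [frob_iter]
        rw [← pow_mul, ← pow_add, he, Nat.sub_add_cancel hij.le]
      exact Nat.pos_of_dvd_of_pos ((hper _).1 this) (by omega)
    rcases lt_or_gt_of_ne hij with h | h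
    · exact aux i j h he
    · exact aux j i h he.symm
  have hxd : x ^ p ^ d = x := (hper d).2 dvd_rfl
  have hnodup : (orb p d x).Nodup := by
    rw [orb, Multiset.nodup_map_iff_inj_on (Multiset.nodup_range d)]
    intro i hi j hj hij
    have := Function.iterate_injOn_Iio_minimalPeriod (f := fun y : L => y ^ p) (x := x)
    exact this (Multiset.mem_range.1 hi) (Multiset.mem_range.1 hj) (by simpa only [frob_iter] using hij)
  have hle : ∀ e : ℕ, orb p (d * e) x ≤ M ↔ e ≤ M.count x := by
    intro e
    rw [orb_mul hxd, Multiset.le_iff_count]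
    constructor
    · intro h
      have := h x
      rw [Multiset.count_nsmul, Multiset.count_eq_one_of_mem hnodup] at this
      · simpa using this
      · rw [orb, Multiset.mem_map]; exact ⟨0, by simpa using hd0, by simp⟩
    · intro h y
      rw [Multiset.count_nsmul]
      by_cases hy : y ∈ orb p d x
      · rw [Multiset.count_eq_one_of_mem hnodup hy, mul_one]
        obtain ⟨i, -, rfl⟩ := Multiset.mem_map.1 hy
        rw [count_orb_stable hM]; exact h
      · rw [Multiset.count_eq_zero_of_notMem hy]; simp
  have : (Finset.Icc 1 M.card).filter (fun k => x ^ p ^ k = x ∧ orb p k x ≤ M) =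
      (Finset.Icc 1 (M.count x)).image (fun e => d * e) := by
    ext k
    simp only [Finset.mem_filter, Finset.mem_Icc, Finset.mem_image, hper]
    constructor
    · rintro ⟨⟨h1, h2⟩, ⟨e, rfl⟩, h4⟩
      exact ⟨e, ⟨Nat.pos_of_ne_zero (by rintro rfl; simp at h1), (hle e).1 h4⟩, rfl⟩
    · rintro ⟨e, ⟨h1, h2⟩, rfl⟩
      have h3 := (hle e).2 h2
      refine ⟨⟨Nat.mul_pos hd0 h1, ?_⟩, ⟨e, rfl⟩, h3⟩
      have := Multiset.card_le_card h3
      rwa [card_orb] at this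
  rw [this, Finset.card_image_of_injective _ (fun a b h => Nat.eq_of_mul_eq_mul_left hd0 h)]
  simp

lemma euler_count [DecidableEq L] {M : Multiset L} (hM : M.map (· ^ p) = M) :
    ∑ k ∈ Finset.Icc 1 M.card, ((FqS L p k).filter (fun x => orb p k x ≤ M)).card = M.card := by
  classical
  have h1 : ∀ k ∈ Finset.Icc 1 M.card, (FqS L p k).filter (fun x => orb p k x ≤ M) =
      M.toFinset.filter (fun x => x ^ p ^ k = x ∧ orb p k x ≤ M) := by
    intro k hk
    have hk := (Finset.mem_Icc.1 hk).1
    ext x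
    simp only [Finset.mem_filter, mem_FqS (show k ≠ 0 by omega), Multiset.mem_toFinset]
    constructor
    · rintro ⟨h1, h2⟩
      exact ⟨Multiset.mem_of_le h2 (by rw [orb, Multiset.mem_map]; exact ⟨0, Multiset.mem_range.2 hk, by simp⟩), h1, h2⟩
    · rintro ⟨h1, h2, h3⟩; exact ⟨h2, h3⟩
  rw [Finset.sum_congr rfl fun k hk => by rw [h1 k hk]]
  simp only [Finset.card_filter]
  rw [Finset.sum_comm]
  simp only [← Finset.card_filter]
  rw [Finset.sum_congr rfl fun x hx => orbit_count hM (Multiset.mem_toFinset.1 hx)]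
  exact Multiset.toFinset_sum_count_eq M

lemma euler_rel (Ψ : AddChar L ℂ) (f : (ZMod p)[X]) (n : ℕ) :
    (n : ℂ) * csum Ψ f n = ∑ k ∈ Finset.Icc 1 n, Ssum Ψ f k * csum Ψ f (n - k) := by
  classical
  have hl : (n : ℂ) * csum Ψ f n = ∑ k ∈ Finset.Icc 1 n, ∑ x ∈ FqS L p k,
      ∑ g ∈ (Mon p n).filter (fun g => orb p k x ≤ rts L g), chi Ψ f g := by
    have h1 : ∀ g ∈ Mon p n, (n : ℂ) * chi Ψ f g = ∑ k ∈ Finset.Icc 1 n, ∑ x ∈ FqS L p k,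
        if orb p k x ≤ rts L g then chi Ψ f g else 0 := by
      intro g hg
      obtain ⟨hgm, hgn⟩ := mem_Mon.1 hg
      have := euler_count (rts_frob (L := L) g)
      rw [card_rts, hgn] at this
      conv_lhs => rw [← this]
      push_cast
      rw [Finset.sum_mul]
      refine Finset.sum_congr rfl fun k _ => ?_
      rw [← Finset.sum_filter, Finset.sum_const, nsmul_eq_mul]
    rw [csum, Finset.mul_sum, Finset.sum_congr rfl h1, Finset.sum_comm]
    refine Finset.sum_congr rfl fun k _ => ?_
    rw [Finset.sum_comm]
    simp only [Finset.sum_filter]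
  rw [hl]
  refine Finset.sum_congr rfl fun k hk => ?_
  obtain ⟨hk1, hkn⟩ := Finset.mem_Icc.1 hk
  rw [Ssum, Finset.sum_mul]
  refine Finset.sum_congr rfl fun x hx => ?_
  rw [mem_FqS (by omega)] at hx
  obtain ⟨q, hq, hqr⟩ := cp_exists hx
  obtain ⟨hqm, hqn⟩ := mem_Mon.1 hq
  have hchi : chi Ψ f q = Ψ (∑ i ∈ Finset.range k, (f.map (algebraMap (ZMod p) L)).eval (x ^ p ^ i)) := by
    rw [chi, hqr, orb, Multiset.map_map]; rfl
  rw [← hchi, csum, Finset.mul_sum]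
  symm
  refine Finset.sum_bij (fun g _ => q * g) ?_ ?_ ?_ ?_
  · intro g hg
    obtain ⟨hgm, hgn⟩ := mem_Mon.1 hg
    rw [Finset.mem_filter, mem_Mon]
    refine ⟨⟨hqm.mul hgm, ?_⟩, ?_⟩
    · rw [hqm.natDegree_mul hgm]; omega
    · rw [rts_mul hqm hgm, hqr]; exact Multiset.le_add_right _ _
  · intro a _ b _ h
    exact mul_left_cancel₀ hqm.ne_zero h
  · intro g hg
    rw [Finset.mem_filter, mem_Mon] at hg
    obtain ⟨⟨hgm, hgn⟩, hle⟩ := hg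
    obtain ⟨g', rfl⟩ := dvd_of_rts_le hgm hqm (hqr ▸ hle)
    have hg'm : g'.Monic := hqm.of_mul_monic_left hgm
    refine ⟨g', mem_Mon.2 ⟨hg'm, ?_⟩, rfl⟩
    rw [hqm.natDegree_mul hg'm] at hgn; omega
  · intro g hg
    rw [chi_mul Ψ f hqm (mem_Mon.1 hg).1]
end

lemma roots_le_one {ι : Type*} [Fintype ι] (a : ι → ℂ) (C : ℝ) (s0 : ℕ)
    (h : ∀ s, s0 ≤ s → ‖∑ i, a i ^ s‖ ≤ C) (i : ι) : ‖a i‖ ≤ 1 := by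
  classical
  by_contra hi
  push Not at hi
  have hu : ∀ i, ∃ u : Circle, a i = ‖a i‖ * (u : ℂ) := by
    intro i
    by_cases h0 : a i = 0
    · exact ⟨1, by simp [h0]⟩
    · refine ⟨⟨a i / ‖a i‖, ?_⟩, ?_⟩
      · change a i / ‖a i‖ ∈ Metric.sphere (0 : ℂ) 1
        simp [h0]
      · have : (‖a i‖ : ℂ) ≠ 0 := by simpa using h0
        simp only
        field_simp
  choose u hu using hu
  have hcl := mapClusterPt_one_atTop_pow (G := ι → Circle) u
  have hU : {v : ι → Circle | ∀ i, 1 / 2 < ((v i : ℂ)).re} ∈ nhds (1 : ι → Circle) := by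
    refine IsOpen.mem_nhds ?_ (by intro i; simp; norm_num)
    rw [Set.ofPred_forall]
    refine isOpen_iInter_of_finite fun i => ?_
    exact isOpen_lt continuous_const (Complex.continuous_re.comp (continuous_subtype_val.comp (continuous_apply i)))
  have hfr := mapClusterPt_iff_frequently.1 hcl _ hU
  have hbig : ∀ᶠ s : ℕ in Filter.atTop, 2 * C < ‖a i‖ ^ s ∧ s0 ≤ s :=
    ((tendsto_pow_atTop_atTop_of_one_lt hi).eventually_gt_atTop _).and (Filter.eventually_ge_atTop s0)
  obtain ⟨s, hs1, hs2, hs3⟩ := (hfr.and_eventually hbig).exists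
  have h1 := (Complex.re_le_norm _).trans (h s hs3)
  have h2 : ∀ j, ‖a j‖ ^ s * (1 / 2) ≤ (a j ^ s).re := by
    intro j
    rw [hu j, mul_pow, norm_mul, Circle.norm_coe, mul_one, Complex.norm_real, norm_norm]
    have := hs1 j
    rw [Pi.pow_apply, Circle.coe_pow] at this
    rw [← Complex.ofReal_pow, Complex.re_ofReal_mul]
    exact mul_le_mul_of_nonneg_left this.le (by positivity)
  have h3 : ‖a i‖ ^ s * (1 / 2) ≤ (∑ j, a j ^ s).re := by
    rw [Complex.re_sum]
    refine (h2 i).trans (Finset.single_le_sum (f := fun j => (a j ^ s).re) (fun j _ => ?_) (Finset.mem_univ i))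
    exact le_trans (by positivity) (h2 j)
  linarith

section
variable {L : Type*} [Field L] [IsAlgClosed L] {p : ℕ} [hp : Fact p.Prime] [CharP L p]
  [Algebra (ZMod p) L]

lemma exists_roots (Ψ : AddChar L ℂ) (hΨ : ∃ t : ZMod p, Ψ (algebraMap (ZMod p) L t) ≠ 1)
    (f : (ZMod p)[X]) (hD : ¬ p ∣ f.natDegree) :
    ∃ R : Multiset ℂ, R.card = f.natDegree - 1 ∧ ∀ k, 1 ≤ k → Ssum Ψ f k = -(R.map (· ^ k)).sum := by
  set D := f.natDegree with hDdef
  have hD0 : 1 ≤ D := Nat.pos_of_ne_zero (by rintro h0; rw [h0] at hD; simp at hD)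
  set Q : ℂ[X] := ∑ i ∈ Finset.range D, C (csum Ψ f i) * X ^ (D - 1 - i) with hQ
  have hcoeff : ∀ i < D, Q.coeff (D - 1 - i) = csum Ψ f i := by
    intro i hi
    rw [hQ, finsetSum_coeff, Finset.sum_eq_single i]
    · rw [coeff_C_mul_X_pow, if_pos rfl]
    · intro j hj hji
      have := Finset.mem_range.1 hj
      rw [coeff_C_mul_X_pow, if_neg (by omega)]
    · intro h; exact absurd (Finset.mem_range.2 hi) h
  have hdeg : Q.natDegree ≤ D - 1 := by
    refine natDegree_sum_le_of_forall_le _ _ fun i _ => ?_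
    exact (natDegree_C_mul_X_pow_le _ _).trans (by omega)
  have hc0 : Q.coeff (D - 1) = 1 := by
    have := hcoeff 0 (by omega)
    rwa [csum_zero, Nat.sub_zero] at this
  have hnd : Q.natDegree = D - 1 := natDegree_eq_of_le_of_coeff_ne_zero hdeg (by rw [hc0]; simp)
  have hm : Q.leadingCoeff = 1 := by rw [leadingCoeff, hnd, hc0]
  have hcard : Q.roots.card = D - 1 := by rw [IsAlgClosed.card_roots_eq_natDegree, hnd]
  refine ⟨Q.roots, hcard, ?_⟩
  have hes : ∀ i, csum Ψ f i = (-1) ^ i * Q.roots.esymm i := by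
    intro i
    by_cases hi : i < D
    · have := coeff_eq_esymm_roots_of_card (p := Q) (IsAlgClosed.card_roots_eq_natDegree) (k := D - 1 - i)
        (by rw [hnd]; omega)
      rw [hnd, hm, one_mul, show D - 1 - (D - 1 - i) = i by omega, hcoeff i hi] at this
      exact this
    · rw [csum_eq_zero Ψ hΨ f hD (by omega), Multiset.esymm, Multiset.powersetCard_eq_empty _ (by omega)]
      simp
  intro k hk
  have hN : ∀ k : ℕ, (k : ℂ) * csum Ψ f k + ∑ i ∈ Finset.range k, csum Ψ f i * (-Ssum Ψ f (k - i)) = 0 := by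
    intro k
    rw [euler_rel]
    have : ∑ k_1 ∈ Finset.Icc 1 k, Ssum Ψ f k_1 * csum Ψ f (k - k_1) =
        ∑ i ∈ Finset.range k, csum Ψ f i * Ssum Ψ f (k - i) := by
      refine Finset.sum_bij' (fun j _ => k - j) (fun i _ => k - i) ?_ ?_ ?_ ?_ ?_
      · intro j hj; simp at hj ⊢; omega
      · intro j hj; simp at hj ⊢; omega
      · intro j hj; simp at hj ⊢; omega
      · intro j hj; simp at hj ⊢; omega
      · intro j hj
        have := Finset.mem_Icc.1 hj
        rw [show k - (k - j) = j by omega, mul_comm]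
    rw [this]
    simp
  have := (newton_compare (c := csum Ψ f) (c' := fun i => (-1) ^ i * Q.roots.esymm i)
    (s := fun j => - Ssum Ψ f j) (s' := fun j => (Q.roots.map (· ^ j)).sum) (csum_zero _ _)
    (by simp [Multiset.esymm]) hN (newton_multiset _) (k + 1) (fun i _ => hes i)).1 k hk (by omega)
  rw [← this, neg_neg]

lemma weil_L (Ψ : AddChar L ℂ) (hΨ : ∃ t : ZMod p, Ψ (algebraMap (ZMod p) L t) ≠ 1)
    (f : (ZMod p)[X]) (hD : ¬ p ∣ f.natDegree) :
    ‖Ssum Ψ f 1‖ ≤ f.natDegree * Real.sqrt p := by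
  obtain ⟨R, hR, hS⟩ := exists_roots Ψ hΨ f hD
  set D := f.natDegree
  have hp0 : (0 : ℝ) < p := by exact_mod_cast hp.out.pos
  have hpc : (p : ℂ) ≠ 0 := by exact_mod_cast hp.out.ne_zero
  obtain ⟨r0, hr0⟩ : ∃ r0 : ℕ, ∀ r ≥ r0, p * (D + 2) * D + 2 * D + 3 < p ^ r :=
    Filter.eventually_atTop.1 ((tendsto_pow_atTop_atTop_of_one_lt hp.out.one_lt).eventually_gt_atTop _)
  obtain ⟨l, rfl⟩ := Quot.exists_rep R
  have hl : (Quot.mk _ l : Multiset ℂ) = (Finset.univ : Finset (Fin l.length)).val.map l.get := by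
    change (l : Multiset ℂ) = _
    rw [Fin.univ_val_map, List.ofFn_get]
  rw [hl] at hR hS
  set a := l.get
  have hS' : ∀ k, 1 ≤ k → Ssum Ψ f k = - ∑ i, a i ^ k := by
    intro k hk
    rw [hS k hk, Multiset.map_map]; rfl
  have hb : ∀ i, ‖a i ^ 2 / p‖ ≤ 1 := by
    refine roots_le_one (fun i => a i ^ 2 / p) (2 * p * (2 * D + 3)) (r0 + 1) ?_
    intro s hs
    obtain ⟨r, rfl⟩ : ∃ r, s = r + 1 := ⟨s - 1, by omega⟩
    have h1 := Ssum_bound Ψ hΨ f hD r (hr0 r (by omega))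
    rw [hS' _ (by omega), norm_neg] at h1
    have h2 : ∑ i, (a i ^ 2 / p) ^ (r + 1) = (∑ i, a i ^ (2 * (r + 1))) / (p : ℂ) ^ (r + 1) := by
      rw [Finset.sum_div]
      refine Finset.sum_congr rfl fun i _ => ?_
      rw [div_pow, pow_mul]
    rw [h2, norm_div, norm_pow, Complex.norm_natCast, div_le_iff₀ (by positivity)]
    exact h1
  have hb' : ∀ i, ‖a i‖ ≤ Real.sqrt p := by
    intro i
    have := hb i
    rw [norm_div, norm_pow, Complex.norm_natCast, div_le_one hp0] at this
    exact Real.le_sqrt_of_sq_le this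
  rw [hS' 1 le_rfl, norm_neg]
  refine (norm_sum_le _ _).trans ?_
  refine (Finset.sum_le_sum (g := fun _ => Real.sqrt p) fun i _ => by simpa using hb' i).trans ?_
  have : l.length = D - 1 := by simpa using hR
  rw [Finset.sum_const, Finset.card_univ, Fintype.card_fin, nsmul_eq_mul, this]
  refine mul_le_mul_of_nonneg_right ?_ (Real.sqrt_nonneg _)
  exact_mod_cast Nat.sub_le _ _
end

theorem weil_bound {p : ℕ} [hp : Fact p.Prime] (ψ : AddChar (ZMod p) ℂ) (hψ : ψ ≠ 1)
    (f : (ZMod p)[X]) (hD : ¬ p ∣ f.natDegree) :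
    ‖∑ t : ZMod p, ψ (f.eval t)‖ ≤ f.natDegree * Real.sqrt p := by
  let L := AlgebraicClosure (ZMod p)
  have hinj : Function.Injective (algebraMap (ZMod p) L) := (algebraMap (ZMod p) L).injective
  haveI : CharP L p := charP_of_injective_algebraMap hinj p
  obtain ⟨ρ, hρ⟩ := LinearMap.exists_leftInverse_of_injective (Algebra.linearMap (ZMod p) L)
    (LinearMap.ker_eq_bot.2 hinj)
  have hρ' : ∀ t, ρ (algebraMap (ZMod p) L t) = t := fun t => by
    have := LinearMap.congr_fun hρ t
    simpa using this
  let Ψ : AddChar L ℂ := ψ.compAddMonoidHom ρ.toAddMonoidHom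
  have hΨv : ∀ t : ZMod p, Ψ (algebraMap (ZMod p) L t) = ψ t := fun t => by
    change ψ (ρ _) = _
    rw [hρ']
  have hΨ : ∃ t : ZMod p, Ψ (algebraMap (ZMod p) L t) ≠ 1 := by
    by_contra hcon
    push Not at hcon
    apply hψ
    ext t
    rw [← hΨv, hcon]; rfl
  have hw := weil_L Ψ hΨ f hD
  convert hw using 2
  rw [Ssum]
  symm
  refine Finset.sum_bij' (i := fun x _ => ρ x) (j := fun t _ => algebraMap (ZMod p) L t) ?_ ?_ ?_ ?_ ?_
  · intro x _; exact Finset.mem_univ _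
  · intro t _; rw [mem_FqS one_ne_zero, pow_one, ← map_pow, ZMod.pow_card]
  · intro x hx
    rw [mem_FqS one_ne_zero, pow_one] at hx
    obtain ⟨t, rfl⟩ := exists_zmod_of_pow hx
    rw [hρ']
  · intro t _; exact hρ' t
  · intro x hx
    rw [mem_FqS one_ne_zero, pow_one] at hx
    obtain ⟨t, rfl⟩ := exists_zmod_of_pow hx
    rw [hρ', Finset.sum_range_one, pow_zero, pow_one, eval_map_algebraMap, aeval_algebraMap_apply, hΨv]
    simp

section
variable {p : ℕ} [hp : Fact p.Prime]

lemma norm_std_sub_one (b : ZMod p) (hb : b ≠ 0) :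
    2 / ‖(ZMod.stdAddChar b : ℂ) - 1‖ ≤ p / 2 * (1 / (b.val : ℝ) + 1 / ((p : ℝ) - b.val)) := by
  have hp0 : (0 : ℝ) < p := by exact_mod_cast hp.out.pos
  set k := b.val with hk
  have hk0 : (0 : ℝ) < k := by
    have : k ≠ 0 := by rw [hk, Ne, ZMod.val_eq_zero]; exact hb
    exact_mod_cast Nat.pos_of_ne_zero this
  have hkp : (k : ℝ) < p := by exact_mod_cast ZMod.val_lt b
  have h1 : ‖(ZMod.stdAddChar b : ℂ) - 1‖ = 2 * |Real.sin (Real.pi * k / p)| := by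
    rw [ZMod.stdAddChar_apply, ZMod.toCircle_apply]
    have := Complex.norm_exp_I_mul_ofReal_sub_one (2 * Real.pi * k / p)
    rw [norm_mul, Real.norm_eq_abs, Real.norm_eq_abs, abs_two] at this
    rw [show 2 * Real.pi * k / p / 2 = Real.pi * k / p by ring] at this
    rw [← this]
    congr 3
    push_cast
    ring
  rw [h1]
  have hpi := Real.pi_pos
  have hq : (0 : ℝ) < p - k := by linarith
  rcases le_total (2 * (k : ℝ)) p with h | h
  · have h2 : 2 / Real.pi * (Real.pi * k / p) ≤ Real.sin (Real.pi * k / p) := by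
      apply Real.mul_le_sin (by positivity)
      rw [div_le_div_iff₀ hp0 two_pos]
      nlinarith
    have h3 : 2 / Real.pi * (Real.pi * k / p) = 2 * k / p := by field_simp
    rw [h3] at h2
    have h4 : 2 * k / p ≤ |Real.sin (Real.pi * k / p)| := h2.trans (le_abs_self _)
    have h5 : 0 < 2 * (k : ℝ) / p := by positivity
    calc 2 / (2 * |Real.sin (Real.pi * k / p)|) ≤ 2 / (2 * (2 * k / p)) := by gcongr
      _ = p / 2 * (1 / (k : ℝ)) := by field_simp
      _ ≤ _ := by
        gcongr
        have : 0 < 1 / ((p : ℝ) - k) := by positivity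
        linarith
  · have h2 : 2 / Real.pi * (Real.pi * (p - k) / p) ≤ Real.sin (Real.pi * (p - k) / p) := by
      apply Real.mul_le_sin (by positivity)
      rw [div_le_div_iff₀ hp0 two_pos]
      nlinarith
    have h3 : 2 / Real.pi * (Real.pi * (p - k) / p) = 2 * (p - k) / p := by field_simp
    have h3' : Real.sin (Real.pi * (p - k) / p) = Real.sin (Real.pi * k / p) := by
      rw [← Real.sin_pi_sub]
      congr 1
      field_simp
      ring
    rw [h3, h3'] at h2
    have h4 : 2 * (p - k) / p ≤ |Real.sin (Real.pi * k / p)| := h2.trans (le_abs_self _)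
    have h5 : 0 < 2 * ((p : ℝ) - k) / p := by positivity
    calc 2 / (2 * |Real.sin (Real.pi * k / p)|) ≤ 2 / (2 * (2 * (p - k) / p)) := by gcongr
      _ = p / 2 * (1 / ((p : ℝ) - k)) := by field_simp
      _ ≤ _ := by
        gcongr
        have : 0 < 1 / (k : ℝ) := by positivity
        linarith

lemma geom_bound_s12 (b s : ZMod p) (hb : b ≠ 0) (K : ℕ) :
    ‖∑ t ∈ Finset.range K, (ZMod.stdAddChar (b * (s + (t : ZMod p))) : ℂ)‖ ≤
      p / 2 * (1 / (b.val : ℝ) + 1 / ((p : ℝ) - b.val)) := by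
  refine le_trans ?_ (norm_std_sub_one b hb)
  have h1 : ∀ t : ℕ, (ZMod.stdAddChar (b * (s + (t : ZMod p))) : ℂ) =
      ZMod.stdAddChar (b * s) * (ZMod.stdAddChar b) ^ t := by
    intro t
    rw [← AddChar.map_nsmul_eq_pow, ← AddChar.map_add_eq_mul]
    congr 1
    rw [nsmul_eq_mul]; ring
  have hne : (ZMod.stdAddChar b : ℂ) ≠ 1 := by
    intro h
    apply hb
    apply ZMod.injective_stdAddChar
    rw [h, AddChar.map_zero_eq_one]
  rw [Finset.sum_congr rfl fun t _ => h1 t, ← Finset.mul_sum, geom_sum_eq hne, norm_mul,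
    AddChar.norm_apply, one_mul, norm_div]
  gcongr
  refine (norm_sub_le _ _).trans ?_
  rw [norm_pow, AddChar.norm_apply]
  norm_num

lemma zmod_sum_val (g : ℕ → ℝ) : ∑ b : ZMod p, g b.val = ∑ k ∈ Finset.range p, g k := by
  refine Finset.sum_bij' (fun b _ => b.val) (fun k _ => (k : ZMod p)) ?_ ?_ ?_ ?_ ?_
  · intro b _; exact Finset.mem_range.2 (ZMod.val_lt b)
  · intro k _; exact Finset.mem_univ _
  · intro b _; exact ZMod.natCast_zmod_val b
  · intro k hk; exact ZMod.val_cast_of_lt (Finset.mem_range.1 hk)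
  · intro b _; rfl

lemma L1_bound (s : ZMod p) (K : ℕ) (hK : K ≤ p) :
    ∑ b : ZMod p, ‖∑ t ∈ Finset.range K, (ZMod.stdAddChar (b * (s + (t : ZMod p))) : ℂ)‖ ≤
      4 * p * Real.log p := by
  have hp0 : (0 : ℝ) < p := by exact_mod_cast hp.out.pos
  have hp2 : (2 : ℝ) ≤ p := by exact_mod_cast hp.out.two_le
  have h1 : ∀ b : ZMod p, ‖∑ t ∈ Finset.range K, (ZMod.stdAddChar (b * (s + (t : ZMod p))) : ℂ)‖ ≤
      (fun k : ℕ => if k = 0 then (p : ℝ) else p / 2 * (1 / (k : ℝ) + 1 / ((p : ℝ) - k))) b.val := by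
    intro b
    simp only
    split_ifs with h
    · refine (norm_sum_le_of_le (n := fun _ => (1 : ℝ)) _ fun t _ => ?_).trans ?_
      · rw [AddChar.norm_apply]
      · simpa using hK
    · exact geom_bound_s12 b s (by rwa [Ne, ← ZMod.val_eq_zero]) K
  refine (Finset.sum_le_sum fun b _ => h1 b).trans ?_
  rw [zmod_sum_val (fun k : ℕ => if k = 0 then (p : ℝ) else p / 2 * (1 / (k : ℝ) + 1 / ((p : ℝ) - k)))]
  obtain ⟨q, hq⟩ : ∃ q, p = q + 1 := ⟨p - 1, by have := hp.out.pos; omega⟩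
  have hr : Finset.range p = Finset.range (q + 1) := by rw [hq]
  have hpq : (p : ℝ) = q + 1 := by rw [hq]; push_cast; ring
  rw [hr, Finset.sum_range_succ']
  simp only [Nat.add_eq_zero_iff, one_ne_zero, and_false, if_false, if_true]
  rw [← Finset.mul_sum, Finset.sum_add_distrib]
  have hh : ∑ i ∈ Finset.range q, 1 / (((i + 1 : ℕ)) : ℝ) = (harmonic q : ℝ) := by
    rw [harmonic]; push_cast
    exact Finset.sum_congr rfl fun i _ => by rw [one_div]
  have hh2 : ∑ i ∈ Finset.range q, 1 / ((p : ℝ) - ((i + 1 : ℕ))) = (harmonic q : ℝ) := by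
    rw [← hh, ← Finset.sum_range_reflect]
    refine Finset.sum_congr rfl fun i hi => ?_
    have := Finset.mem_range.1 hi
    congr 1
    rw [hpq, show q - 1 - i = q - (i + 1) by omega]
    push_cast [Nat.cast_sub (show i + 1 ≤ q by omega)]
    ring
  rw [hh, hh2]
  have hlog : Real.log q ≤ Real.log p := by
    rcases Nat.eq_zero_or_pos q with h0 | h0
    · rw [h0]; simp; exact Real.log_nonneg (by linarith)
    · exact Real.log_le_log (by exact_mod_cast h0) (by rw [hpq]; linarith)
  have hH := harmonic_le_one_add_log q
  have hl2 : (0.6931471803 : ℝ) < Real.log p := Real.log_two_gt_d9.trans_le (Real.log_le_log two_pos hp2)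
  nlinarith

lemma orth (y : ZMod p) : ∑ b : ZMod p, (ZMod.stdAddChar (b * y) : ℂ) = if y = 0 then (p : ℂ) else 0 := by
  have := AddChar.sum_mulShift (ψ := (ZMod.stdAddChar : AddChar (ZMod p) ℂ)) y (ZMod.isPrimitive_stdAddChar p)
  rw [this, ZMod.card]
  split_ifs <;> simp

/-- Fourier expansion of the indicator of an interval -/
lemma indicator_fourier (s y : ZMod p) (K : ℕ) :
    ∑ b : ZMod p, (∑ t ∈ Finset.range K, (ZMod.stdAddChar (b * (-s - (t : ZMod p))) : ℂ)) * ZMod.stdAddChar (b * y)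
      = p * ∑ t ∈ Finset.range K, if y = s + t then (1 : ℂ) else 0 := by
  simp_rw [Finset.sum_mul]
  rw [Finset.sum_comm, Finset.mul_sum]
  refine Finset.sum_congr rfl fun t _ => ?_
  have : ∀ b : ZMod p, (ZMod.stdAddChar (b * (-s - (t : ZMod p))) : ℂ) * ZMod.stdAddChar (b * y) =
      ZMod.stdAddChar (b * (y - (s + (t : ZMod p)))) := by
    intro b
    rw [← AddChar.map_add_eq_mul]; congr 1; ring
  simp_rw [this]
  rw [orth]
  simp only [sub_eq_zero]
  split_ifs <;> simp

lemma L1_bound' (s : ZMod p) (K : ℕ) (hK : K ≤ p) :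
    ∑ b : ZMod p, ‖∑ t ∈ Finset.range K, (ZMod.stdAddChar (b * (-s - (t : ZMod p))) : ℂ)‖ ≤
      4 * p * Real.log p := by
  rw [← Equiv.sum_comp (Equiv.neg (ZMod p))]
  convert L1_bound s K hK using 5
  simp only [Equiv.neg_apply]; ring

lemma incomplete_bound (g : (ZMod p)[X]) (h2 : 2 ≤ g.natDegree) (hlt : g.natDegree < p)
    (s : ZMod p) (K : ℕ) (hK : K ≤ p) :
    ‖∑ t ∈ Finset.range K, (ZMod.stdAddChar (g.eval (s + (t : ZMod p))) : ℂ)‖ ≤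
      4 * g.natDegree * Real.sqrt p * Real.log p := by
  have hp0 : (0 : ℝ) < p := by exact_mod_cast hp.out.pos
  have hpc : (p : ℂ) ≠ 0 := by exact_mod_cast hp.out.ne_zero
  have key : (p : ℂ) * ∑ t ∈ Finset.range K, (ZMod.stdAddChar (g.eval (s + (t : ZMod p))) : ℂ) =
      ∑ b : ZMod p, (∑ t ∈ Finset.range K, (ZMod.stdAddChar (b * (-s - (t : ZMod p))) : ℂ)) *
        ∑ y : ZMod p, ZMod.stdAddChar ((g + C b * X).eval y) := by
    have h1 : ∀ b : ZMod p, (∑ t ∈ Finset.range K, (ZMod.stdAddChar (b * (-s - (t : ZMod p))) : ℂ)) *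
        ∑ y : ZMod p, ZMod.stdAddChar ((g + C b * X).eval y) = ∑ y : ZMod p,
        ((∑ t ∈ Finset.range K, (ZMod.stdAddChar (b * (-s - (t : ZMod p))) : ℂ)) * ZMod.stdAddChar (b * y)) *
          ZMod.stdAddChar (g.eval y) := by
      intro b
      rw [Finset.mul_sum]
      refine Finset.sum_congr rfl fun y _ => ?_
      rw [eval_add, eval_mul, eval_C, eval_X, AddChar.map_add_eq_mul]
      ring
    simp_rw [h1]
    rw [Finset.sum_comm]
    simp_rw [← Finset.sum_mul, indicator_fourier, mul_assoc, ← Finset.mul_sum]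
    congr 1
    simp_rw [Finset.sum_mul]
    rw [Finset.sum_comm]
    refine Finset.sum_congr rfl fun t _ => ?_
    simp
  have hψ : (ZMod.stdAddChar : AddChar (ZMod p) ℂ) ≠ 1 := by
    intro h
    have := ZMod.injective_stdAddChar (N := p) (a₁ := 1) (a₂ := 0) (by rw [h]; simp)
    exact one_ne_zero this
  have hb : ∀ b : ZMod p, ‖∑ y : ZMod p, (ZMod.stdAddChar ((g + C b * X).eval y) : ℂ)‖ ≤ g.natDegree * Real.sqrt p := by
    intro b
    have hd : (g + C b * X).natDegree = g.natDegree := by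
      apply natDegree_add_eq_left_of_natDegree_lt
      refine lt_of_le_of_lt (natDegree_C_mul_le _ _) ?_
      rw [natDegree_X]; omega
    rw [← hd]
    apply weil_bound _ hψ
    rw [hd]
    exact fun h => absurd (Nat.le_of_dvd (by omega) h) (by omega)
  have h3 := congrArg norm key
  rw [norm_mul, Complex.norm_natCast] at h3
  have h4 : (p : ℝ) * ‖∑ t ∈ Finset.range K, (ZMod.stdAddChar (g.eval (s + (t : ZMod p))) : ℂ)‖ ≤
      (4 * p * Real.log p) * (g.natDegree * Real.sqrt p) := by
    rw [h3]
    refine (norm_sum_le _ _).trans ?_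
    refine le_trans ?_ (mul_le_mul_of_nonneg_right (L1_bound' s K hK) (by positivity))
    rw [Finset.sum_mul]
    refine Finset.sum_le_sum fun b _ => ?_
    rw [norm_mul]
    exact mul_le_mul_of_nonneg_left (hb b) (norm_nonneg _)
  refine le_of_mul_le_mul_left (h4.trans (le_of_eq ?_)) hp0
  ring
end

section
variable {p : ℕ} [hp : Fact p.Prime] {m : ℕ}

noncomputable def lineP (z v : Fin m → ZMod p) (F : MvPolynomial (Fin m) (ZMod p)) : (ZMod p)[X] :=
  MvPolynomial.eval₂ C (fun i => C (v i) * X + C (z i)) F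

lemma lineP_eval (z v : Fin m → ZMod p) (F : MvPolynomial (Fin m) (ZMod p)) (t : ZMod p) :
    (lineP z v F).eval t = MvPolynomial.eval (fun i => z i + t * v i) F := by
  rw [lineP, MvPolynomial.eval₂_eq', MvPolynomial.eval_eq', eval_finsetSum]
  refine Finset.sum_congr rfl fun s _ => ?_
  rw [eval_mul, eval_C, eval_prod]
  congr 1
  refine Finset.prod_congr rfl fun i _ => ?_
  simp
  ring

lemma line_monomial (z v : Fin m → ZMod p) (s : Fin m →₀ ℕ) (S : Finset (Fin m)) :
    (∏ i ∈ S, (C (v i) * X + C (z i)) ^ s i).natDegree ≤ ∑ i ∈ S, s i ∧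
    (∏ i ∈ S, (C (v i) * X + C (z i)) ^ s i).coeff (∑ i ∈ S, s i) = ∏ i ∈ S, v i ^ s i := by
  classical
  induction S using Finset.induction_on with
  | empty => simp
  | insert a S ha ih =>
    rw [Finset.prod_insert ha, Finset.sum_insert ha, Finset.prod_insert ha]
    have h1 : (C (v a) * X + C (z a)).natDegree ≤ 1 := natDegree_linear_le
    have h2 : ((C (v a) * X + C (z a)) ^ s a).natDegree ≤ s a := by
      refine natDegree_pow_le.trans ?_
      calc s a * _ ≤ s a * 1 := Nat.mul_le_mul_left _ h1
        _ = s a := mul_one _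
    refine ⟨natDegree_mul_le.trans (add_le_add h2 ih.1), ?_⟩
    rw [coeff_mul_add_eq_of_natDegree_le h2 ih.1, ih.2]
    congr 1
    have := coeff_pow_of_natDegree_le (m := s a) h1
    rw [mul_one] at this
    rw [this]
    simp

lemma lineP_coeff (z v : Fin m → ZMod p) (F : MvPolynomial (Fin m) (ZMod p)) :
    (lineP z v F).natDegree ≤ F.totalDegree ∧
    (lineP z v F).coeff F.totalDegree =
      MvPolynomial.eval v (MvPolynomial.homogeneousComponent F.totalDegree F) := by
  classical
  have hdeg : ∀ s ∈ F.support, ∑ i, s i ≤ F.totalDegree := by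
    intro s hs
    have := MvPolynomial.le_totalDegree hs
    rwa [Finsupp.sum_fintype _ _ (fun _ => rfl)] at this
  constructor
  · rw [lineP, MvPolynomial.eval₂_eq']
    refine natDegree_sum_le_of_forall_le _ _ fun s hs => ?_
    exact (natDegree_C_mul_le _ _).trans ((line_monomial z v s Finset.univ).1.trans (hdeg s hs))
  · rw [lineP, MvPolynomial.eval₂_eq', MvPolynomial.homogeneousComponent_apply, map_sum, finsetSum_coeff,
      Finset.sum_filter]
    refine Finset.sum_congr rfl fun s hs => ?_
    rw [coeff_C_mul]
    obtain ⟨h1, h2⟩ := line_monomial z v s Finset.univ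
    rw [Finsupp.degree_eq_sum]
    split_ifs with h
    · rw [← h, h2, MvPolynomial.eval_monomial, Finsupp.prod_fintype _ _ (fun _ => by simp)]
    · rw [coeff_eq_zero_of_natDegree_lt, mul_zero]
      exact lt_of_le_of_lt h1 (lt_of_le_of_ne (hdeg s hs) h)

lemma exists_dir {d : ℕ} (F : MvPolynomial (Fin m) (ZMod p)) (h2 : 2 ≤ F.totalDegree)
    (hd : F.totalDegree ≤ d) (hdp : d < p) :
    ∃ v : Fin m → ℕ, (∀ i, v i ≤ d) ∧ (∃ i, 1 ≤ v i) ∧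
      MvPolynomial.eval (fun i => (v i : ZMod p)) (MvPolynomial.homogeneousComponent F.totalDegree F) ≠ 0 := by
  classical
  set H := MvPolynomial.homogeneousComponent F.totalDegree F with hH
  have hH0 : H ≠ 0 := by
    intro h0
    have hF0 : F ≠ 0 := by rintro rfl; simp at h2
    obtain ⟨s, hs, hs2⟩ := Finset.exists_mem_eq_sup F.support
      (MvPolynomial.support_nonempty.2 hF0) (fun s => s.sum fun _ e => e)
    have : MvPolynomial.coeff s H = MvPolynomial.coeff s F := by
      rw [hH, MvPolynomial.coeff_homogeneousComponent, if_pos]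
      rw [MvPolynomial.totalDegree, hs2, Finsupp.degree_eq_sum, Finsupp.sum_fintype _ _ (fun _ => rfl)]
    rw [h0, MvPolynomial.coeff_zero] at this
    exact MvPolynomial.mem_support_iff.1 hs this.symm
  have hHh : H.IsHomogeneous F.totalDegree := MvPolynomial.homogeneousComponent_isHomogeneous _ _
  have hinj : Set.InjOn (fun k : ℕ => (k : ZMod p)) (Finset.range (d + 1) : Set ℕ) := by
    intro a ha b hb hab
    have ha := Finset.mem_range.1 ha
    have hb := Finset.mem_range.1 hb
    have := congrArg ZMod.val hab
    rwa [ZMod.val_cast_of_lt (by omega), ZMod.val_cast_of_lt (by omega)] at this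
  by_contra hcon
  push Not at hcon
  apply hH0
  apply MvPolynomial.eq_zero_of_eval_zero_at_prod_finset H (fun _ => (Finset.range (d + 1)).image (fun k : ℕ => (k : ZMod p)))
  · intro i
    rw [Finset.card_image_of_injOn hinj, Finset.card_range]
    have := MvPolynomial.degreeOf_le_totalDegree H i
    have := hHh.totalDegree hH0
    omega
  · intro x hx
    choose v hv hvx using fun i => Finset.mem_image.1 (hx i)
    have hx' : x = fun i => (v i : ZMod p) := by ext i; exact (hvx i).symm
    by_cases h0 : ∃ i, 1 ≤ v i
    · rw [hx']
      exact hcon v (fun i => by have := Finset.mem_range.1 (hv i); omega) h0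
    · push Not at h0
      have : x = 0 := by
        rw [hx']; ext i
        have := h0 i
        have : v i = 0 := by omega
        simp [this]
      rw [this, MvPolynomial.eval_zero]
      rw [MvPolynomial.constantCoeff_eq]
      by_contra h
      have := hHh h
      simp at this
      omega

lemma convex_finset (T : Finset ℤ) (hT : T.Nonempty)
    (h : ∀ a ∈ T, ∀ b ∈ T, ∀ t, a ≤ t → t ≤ b → t ∈ T) :
    ∃ a : ℤ, ∃ K : ℕ, T = (Finset.range K).image (fun t : ℕ => a + (t : ℤ)) ∧ a ∈ T ∧ a + K - 1 ∈ T := by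
  have h1 := T.min'_mem hT
  have h2 := T.max'_mem hT
  have h3 := T.min'_le _ h2
  refine ⟨T.min' hT, (T.max' hT - T.min' hT + 1).toNat, ?_, h1, ?_⟩
  · ext t
    simp only [Finset.mem_image, Finset.mem_range]
    constructor
    · intro ht
      have h4 := T.min'_le _ ht
      have h5 := T.le_max' _ ht
      exact ⟨(t - T.min' hT).toNat, by omega, by omega⟩
    · rintro ⟨k, hk, rfl⟩
      exact h _ h1 _ h2 _ (by omega) (by omega)
  · convert h2 using 1
    omega

lemma cube_bound {d : ℕ} (F : MvPolynomial (Fin m) (ZMod p)) (h2 : 2 ≤ F.totalDegree)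
    (hd : F.totalDegree ≤ d) (hdp : d < p) (u w : ℤ) (hw1 : 1 ≤ w) (hwp : w < p) :
    ‖∑ x ∈ Fintype.piFinset (fun _ : Fin m => Finset.Icc u (u + w)),
      (ZMod.stdAddChar (MvPolynomial.eval (fun i => ((x i : ℤ) : ZMod p)) F) : ℂ)‖ ≤
    ((d + 2 : ℝ) ^ m * (w : ℝ) ^ (m - 1)) * (4 * d * Real.sqrt p * Real.log p) := by
  classical
  have hp1 : (1 : ℝ) ≤ p := by exact_mod_cast hp.out.one_le
  have hlog : 0 ≤ Real.log p := Real.log_nonneg hp1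
  obtain ⟨v, hvd, ⟨i0, hi0⟩, hv⟩ := exists_dir F h2 hd hdp
  set Q := Fintype.piFinset (fun _ : Fin m => Finset.Icc u (u + w)) with hQ
  have hQm : ∀ x, x ∈ Q ↔ ∀ i, u ≤ x i ∧ x i ≤ u + w := by
    intro x; simp [hQ, Fintype.mem_piFinset]
  let τ : (Fin m → ℤ) → ℤ := fun x => (x i0 - u) / (v i0 : ℤ)
  let ζ : (Fin m → ℤ) → (Fin m → ℤ) := fun x i => x i - τ x * v i
  have hv0 : (0 : ℤ) < v i0 := by exact_mod_cast hi0
  have hτ0 : ∀ x ∈ Q, 0 ≤ τ x ∧ τ x ≤ w := by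
    intro x hx
    have := (hQm x).1 hx i0
    refine ⟨Int.ediv_nonneg (by omega) hv0.le, ?_⟩
    exact (Int.ediv_le_self _ (by omega)).trans (by omega)
  -- image bound
  have himg : ((Q.image ζ).card : ℝ) ≤ (d + 2 : ℝ) ^ m * (w : ℝ) ^ (m - 1) := by
    have hsub : Q.image ζ ⊆ Fintype.piFinset (fun i : Fin m => if i = i0 then Finset.Icc u (u + d)
        else Finset.Icc (u - w * d) (u + w)) := by
      intro z hz
      obtain ⟨x, hx, rfl⟩ := Finset.mem_image.1 hz
      rw [Fintype.mem_piFinset]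
      intro i
      have hxi := (hQm x).1 hx i
      have ht := hτ0 x hx
      have hvi : (v i : ℤ) ≤ d := by exact_mod_cast hvd i
      split_ifs with hi
      · subst hi
        have e : ζ x i = u + (x i - u) % (v i : ℤ) := by
          simp only [ζ, τ]
          have := Int.emod_add_mul_ediv (x i - u) (v i)
          linarith
        rw [Finset.mem_Icc, e]
        have h1 := Int.emod_nonneg (x i - u) hv0.ne'
        have h2 := Int.emod_lt_of_pos (x i - u) hv0
        omega
      · rw [Finset.mem_Icc]
        simp only [ζ]
        have h1 : 0 ≤ τ x * v i := mul_nonneg ht.1 (by positivity)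
        have h2 : τ x * v i ≤ w * d := mul_le_mul ht.2 hvi (by positivity) (by omega)
        omega
    have hc := Finset.card_le_card hsub
    rw [Fintype.card_piFinset, ← Finset.mul_prod_erase Finset.univ _ (Finset.mem_univ i0), if_pos rfl] at hc
    rw [Finset.prod_congr rfl (g := fun _ => (Finset.Icc (u - w * d) (u + w)).card)
      (fun i hi => by rw [if_neg (Finset.ne_of_mem_erase hi)])] at hc
    rw [Finset.prod_const, Finset.card_erase_of_mem (Finset.mem_univ _), Finset.card_univ, Fintype.card_fin,
      Int.card_Icc, Int.card_Icc] at hc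
    have hw0 : (1 : ℝ) ≤ w := by exact_mod_cast hw1
    have e1 : (((u + d + 1 - u).toNat : ℕ) : ℝ) ≤ d + 2 := by
      have : (u + d + 1 - u).toNat = d + 1 := by omega
      rw [this]; push_cast; linarith
    have e2 : (((u + w + 1 - (u - w * d)).toNat : ℕ) : ℝ) ≤ (d + 2) * w := by
      have hnn : 0 ≤ u + w + 1 - (u - w * d) := by
        have : 0 ≤ w * d := by positivity
        linarith
      have : (((u + w + 1 - (u - w * d)).toNat : ℤ) : ℝ) = ((u + w + 1 - (u - w * d) : ℤ) : ℝ) := by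
        rw [Int.toNat_of_nonneg hnn]
      rw [Int.cast_natCast] at this
      rw [this]; push_cast; nlinarith
    have hm : m = (m - 1) + 1 := by have := i0.pos; omega
    calc ((Q.image ζ).card : ℝ) ≤ ((u + d + 1 - u).toNat : ℝ) * ((u + w + 1 - (u - w * d)).toNat : ℝ) ^ (m - 1) := by
          exact_mod_cast hc
      _ ≤ (d + 2) * ((d + 2) * w) ^ (m - 1) := by gcongr
      _ = (d + 2 : ℝ) ^ (m - 1 + 1) * (w : ℝ) ^ (m - 1) := by rw [mul_pow, pow_succ]; ring
      _ = _ := by rw [← hm]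
  rw [← Finset.sum_fiberwise_of_maps_to (t := Q.image ζ) (g := ζ) (fun x hx => Finset.mem_image_of_mem _ hx)]
  refine (norm_sum_le_of_le (n := fun _ => 4 * d * Real.sqrt p * Real.log p) _ ?_).trans ?_
  swap
  · rw [Finset.sum_const, nsmul_eq_mul]
    exact mul_le_mul_of_nonneg_right himg (by positivity)
  intro z hz
  obtain ⟨x0, hx0, hx0z⟩ := Finset.mem_image.1 hz
  set Fb := Q.filter (fun x => ζ x = z) with hFb
  have hxrep : ∀ x ∈ Fb, ∀ i, x i = z i + τ x * v i := by
    intro x hx i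
    have := congrFun (Finset.mem_filter.1 hx).2 i
    simp only [ζ] at this
    linarith
  have hτinj : Set.InjOn τ (Fb : Set (Fin m → ℤ)) := by
    intro x hx y hy hxy
    ext i
    rw [hxrep x hx i, hxrep y hy i, hxy]
  obtain ⟨a, K, hT, haT, hbT⟩ := convex_finset (Fb.image τ) ⟨τ x0, Finset.mem_image_of_mem _
      (Finset.mem_filter.2 ⟨hx0, hx0z⟩)⟩ (by
    intro a ha b hb t hat htb
    obtain ⟨x, hx, rfl⟩ := Finset.mem_image.1 ha
    obtain ⟨y, hy, rfl⟩ := Finset.mem_image.1 hb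
    have hxQ := (hQm x).1 (Finset.mem_filter.1 hx).1
    have hyQ := (hQm y).1 (Finset.mem_filter.1 hy).1
    have hz0 : (z i0 - u) / (v i0 : ℤ) = 0 := by
      have : τ x = (z i0 - u) / (v i0 : ℤ) + τ x := by
        conv_lhs => simp only [τ]
        rw [hxrep x hx i0, show z i0 + τ x * v i0 - u = z i0 - u + τ x * v i0 by ring,
          Int.add_mul_ediv_right _ _ hv0.ne']
      linarith
    have hτt : τ (fun i => z i + t * v i) = t := by
      simp only [τ]
      rw [show z i0 + t * v i0 - u = z i0 - u + t * v i0 by ring, Int.add_mul_ediv_right _ _ hv0.ne', hz0, zero_add]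
    refine Finset.mem_image.2 ⟨fun i => z i + t * v i, Finset.mem_filter.2 ⟨(hQm _).2 ?_, ?_⟩, hτt⟩
    · intro i
      have h1 := hxrep x hx i
      have h2 := hxrep y hy i
      have h3 : τ x * v i ≤ t * v i := mul_le_mul_of_nonneg_right hat (by positivity)
      have h4 : t * v i ≤ τ y * v i := mul_le_mul_of_nonneg_right htb (by positivity)
      have := hxQ i
      have := hyQ i
      constructor <;> linarith
    · ext i
      simp only [ζ]
      rw [hτt]; ring)
  have hKp : K ≤ p := by
    obtain ⟨x, hx, hxa⟩ := Finset.mem_image.1 haT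
    obtain ⟨y, hy, hyb⟩ := Finset.mem_image.1 hbT
    have h1 := hτ0 x (Finset.mem_filter.1 hx).1
    have h2 := hτ0 y (Finset.mem_filter.1 hy).1
    omega
  have hsum : ∑ x ∈ Fb, (ZMod.stdAddChar (MvPolynomial.eval (fun i => ((x i : ℤ) : ZMod p)) F) : ℂ) =
      ∑ t ∈ Finset.range K, (ZMod.stdAddChar ((lineP (fun i => ((z i : ℤ) : ZMod p)) (fun i => (v i : ZMod p)) F).eval
        ((a : ZMod p) + (t : ZMod p))) : ℂ) := by
    have e1 : ∑ x ∈ Fb, (ZMod.stdAddChar (MvPolynomial.eval (fun i => ((x i : ℤ) : ZMod p)) F) : ℂ) =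
        ∑ t ∈ Fb.image τ, (ZMod.stdAddChar ((lineP (fun i => ((z i : ℤ) : ZMod p)) (fun i => (v i : ZMod p)) F).eval
        (t : ZMod p)) : ℂ) := by
      rw [Finset.sum_image hτinj]
      refine Finset.sum_congr rfl fun x hx => ?_
      rw [lineP_eval]
      congr 3
      ext i
      rw [hxrep x hx i]; push_cast; rfl
    rw [e1, hT, Finset.sum_image (fun x _ y _ h => by simpa using h)]
    refine Finset.sum_congr rfl fun t _ => ?_
    push_cast; rfl
  rw [hsum]
  obtain ⟨l1, l2⟩ := lineP_coeff (fun i => ((z i : ℤ) : ZMod p)) (fun i => (v i : ZMod p)) F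
  have hnd : (lineP (fun i => ((z i : ℤ) : ZMod p)) (fun i => (v i : ZMod p)) F).natDegree = F.totalDegree :=
    natDegree_eq_of_le_of_coeff_ne_zero l1 (by rw [l2]; exact hv)
  refine (incomplete_bound _ (by rw [hnd]; exact h2) (by rw [hnd]; omega) _ K hKp).trans ?_
  rw [hnd]
  gcongr
end

end AuxPoly

lemma addChar_sum {A ι : Type*} [AddCommMonoid A] (ψ : AddChar A ℂ) (s : Finset ι) (f : ι → A) :
    ψ (∑ i ∈ s, f i) = ∏ i ∈ s, ψ (f i) := by
  classical
  induction s using Finset.induction_on with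
  | empty => simp
  | insert i s hi ih => rw [Finset.sum_insert hi, Finset.prod_insert hi, AddChar.map_add_eq_mul, ih]

lemma prod_diff_bound {ι : Type*} (s : Finset ι) (a b : ι → ℝ) (ε : ℝ)
    (ha : ∀ i ∈ s, 0 ≤ a i ∧ a i ≤ 1) (hb : ∀ i ∈ s, 0 ≤ b i ∧ b i ≤ 1) (h : ∀ i ∈ s, |a i - b i| ≤ ε) :
    |∏ i ∈ s, a i - ∏ i ∈ s, b i| ≤ s.card * ε := by
  classical
  induction s using Finset.induction_on with
  | empty => simp
  | insert i s hi ih =>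
    have ih := ih (fun j hj => ha j (Finset.mem_insert_of_mem hj)) (fun j hj => hb j (Finset.mem_insert_of_mem hj))
      (fun j hj => h j (Finset.mem_insert_of_mem hj))
    have h0 := h i (Finset.mem_insert_self _ _)
    have ha0 := ha i (Finset.mem_insert_self _ _)
    have hB0 : 0 ≤ ∏ j ∈ s, b j := Finset.prod_nonneg fun j hj => (hb j (Finset.mem_insert_of_mem hj)).1
    have hB1 : ∏ j ∈ s, b j ≤ 1 := Finset.prod_le_one (fun j hj => (hb j (Finset.mem_insert_of_mem hj)).1)
      (fun j hj => (hb j (Finset.mem_insert_of_mem hj)).2)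
    rw [Finset.prod_insert hi, Finset.prod_insert hi, Finset.card_insert_of_notMem hi]
    have e : a i * ∏ j ∈ s, a j - b i * ∏ j ∈ s, b j =
        a i * (∏ j ∈ s, a j - ∏ j ∈ s, b j) + (a i - b i) * ∏ j ∈ s, b j := by ring
    rw [e]
    refine (abs_add_le _ _).trans ?_
    rw [abs_mul, abs_mul, abs_of_nonneg ha0.1, abs_of_nonneg hB0]
    push_cast
    have h1 : a i * |∏ j ∈ s, a j - ∏ j ∈ s, b j| ≤ |∏ j ∈ s, a j - ∏ j ∈ s, b j| :=
      mul_le_of_le_one_left (abs_nonneg _) ha0.2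
    have h2 : |a i - b i| * ∏ j ∈ s, b j ≤ |a i - b i| := mul_le_of_le_one_right (abs_nonneg _) hB1
    linarith

section
variable {p : ℕ} [hp : Fact p.Prime] {m n : ℕ}

lemma ind_interval (y : ZMod p) (A K : ℕ) (hAK : A + K ≤ p) :
    (∑ t ∈ Finset.range K, if y = (A : ZMod p) + (t : ZMod p) then (1 : ℂ) else 0) =
      if A ≤ y.val ∧ y.val < A + K then 1 else 0 := by
  have h1 : ∀ t ∈ Finset.range K, (y = (A : ZMod p) + (t : ZMod p) ↔ y.val = A + t) := by
    intro t ht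
    have ht := Finset.mem_range.1 ht
    constructor
    · rintro rfl
      rw [← Nat.cast_add, ZMod.val_cast_of_lt (by omega)]
    · intro h
      rw [← ZMod.natCast_zmod_val y, h]; push_cast; rfl
  rw [Finset.sum_congr rfl fun t ht => if_congr (h1 t ht) rfl rfl]
  split_ifs with h
  · rw [Finset.sum_eq_single (y.val - A)]
    · rw [if_pos (by omega)]
    · intro t _ ht
      rw [if_neg (by omega)]
    · intro hn
      exact absurd (Finset.mem_range.2 (by omega)) hn
  · refine Finset.sum_eq_zero fun t ht => ?_
    have := Finset.mem_range.1 ht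
    rw [if_neg (by omega)]

/-- finite Fourier (Erdős–Turán–Koksma type) counting estimate -/
lemma count_est {ι : Type*} (Q : Finset ι) (y : ι → Fin n → ZMod p) (E : ℝ) (hE : 0 ≤ E)
    (hS : ∀ a : Fin n → ZMod p, a ≠ 0 → ‖∑ x ∈ Q, (ZMod.stdAddChar (∑ j, a j * y x j) : ℂ)‖ ≤ E)
    (A K : Fin n → ℕ) (hAK : ∀ j, A j + K j ≤ p) :
    |((Q.filter (fun x => ∀ j, A j ≤ (y x j).val ∧ (y x j).val < A j + K j)).card : ℝ) -
      Q.card * ∏ j, ((K j : ℝ) / p)| ≤ (4 * Real.log p) ^ n * E := by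
  classical
  have hp0 : (0 : ℝ) < p := by exact_mod_cast hp.out.pos
  have hpc : (p : ℂ) ≠ 0 := by exact_mod_cast hp.out.ne_zero
  let c : Fin n → ZMod p → ℂ := fun j b => ∑ t ∈ Finset.range (K j), (ZMod.stdAddChar (b * (-(A j : ZMod p) - (t : ZMod p))) : ℂ)
  have hcard : (p : ℂ) ^ n * ((Q.filter (fun x => ∀ j, A j ≤ (y x j).val ∧ (y x j).val < A j + K j)).card : ℂ) =
      ∑ a : Fin n → ZMod p, (∏ j, c j (a j)) * ∑ x ∈ Q, (ZMod.stdAddChar (∑ j, a j * y x j) : ℂ) := by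
    have h1 : ∀ x, (p : ℂ) ^ n * (if ∀ j, A j ≤ (y x j).val ∧ (y x j).val < A j + K j then 1 else 0) =
        ∑ a : Fin n → ZMod p, (∏ j, c j (a j)) * (ZMod.stdAddChar (∑ j, a j * y x j) : ℂ) := by
      intro x
      have h2 : (if ∀ j, A j ≤ (y x j).val ∧ (y x j).val < A j + K j then (1 : ℂ) else 0) =
          ∏ j, if A j ≤ (y x j).val ∧ (y x j).val < A j + K j then (1 : ℂ) else 0 := by
        rw [Finset.prod_ite_zero]; simp
      rw [h2, show (p : ℂ) ^ n = ∏ _j : Fin n, (p : ℂ) by simp, ← Finset.prod_mul_distrib]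
      have h3 : ∀ j, (p : ℂ) * (if A j ≤ (y x j).val ∧ (y x j).val < A j + K j then (1 : ℂ) else 0) =
          ∑ b : ZMod p, c j b * ZMod.stdAddChar (b * y x j) := by
        intro j
        rw [← ind_interval _ _ _ (hAK j), ← indicator_fourier]
      rw [Finset.prod_congr rfl fun j _ => h3 j, Finset.prod_univ_sum, Fintype.piFinset_univ]
      refine Finset.sum_congr rfl fun a _ => ?_
      rw [Finset.prod_mul_distrib]
      congr 1
      rw [addChar_sum]
    rw [Finset.card_filter]
    push_cast
    rw [Finset.mul_sum, Finset.sum_congr rfl fun x _ => h1 x, Finset.sum_comm]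
    refine Finset.sum_congr rfl fun a _ => ?_
    rw [Finset.mul_sum]
  rw [← Finset.add_sum_erase _ _ (Finset.mem_univ (0 : Fin n → ZMod p))] at hcard
  have h0 : (∏ j, c j ((0 : Fin n → ZMod p) j)) * ∑ x ∈ Q, (ZMod.stdAddChar (∑ j, (0 : Fin n → ZMod p) j * y x j) : ℂ) =
      (∏ j, (K j : ℂ)) * Q.card := by
    simp [c]
  rw [h0] at hcard
  have hdiff : (p : ℂ) ^ n * (((Q.filter (fun x => ∀ j, A j ≤ (y x j).val ∧ (y x j).val < A j + K j)).card : ℂ) -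
      Q.card * ∏ j, ((K j : ℂ) / p)) = ∑ a ∈ Finset.univ.erase (0 : Fin n → ZMod p),
      (∏ j, c j (a j)) * ∑ x ∈ Q, (ZMod.stdAddChar (∑ j, a j * y x j) : ℂ) := by
    rw [mul_sub, hcard, Finset.prod_div_distrib]
    simp only [Finset.prod_const, Finset.card_univ, Fintype.card_fin]
    field_simp
    ring
  have hnorm := congrArg norm hdiff
  have hle : ‖∑ a ∈ Finset.univ.erase (0 : Fin n → ZMod p),
      (∏ j, c j (a j)) * ∑ x ∈ Q, (ZMod.stdAddChar (∑ j, a j * y x j) : ℂ)‖ ≤ (4 * p * Real.log p) ^ n * E := by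
    refine (norm_sum_le _ _).trans ?_
    calc ∑ a ∈ Finset.univ.erase (0 : Fin n → ZMod p), ‖(∏ j, c j (a j)) * ∑ x ∈ Q, (ZMod.stdAddChar (∑ j, a j * y x j) : ℂ)‖
        ≤ ∑ a ∈ Finset.univ.erase (0 : Fin n → ZMod p), (∏ j, ‖c j (a j)‖) * E := by
          refine Finset.sum_le_sum fun a ha => ?_
          rw [norm_mul, norm_prod]
          exact mul_le_mul_of_nonneg_left (hS a (Finset.ne_of_mem_erase ha)) (Finset.prod_nonneg fun _ _ => norm_nonneg _)
      _ ≤ ∑ a : Fin n → ZMod p, (∏ j, ‖c j (a j)‖) * E :=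
          Finset.sum_le_sum_of_subset_of_nonneg (Finset.erase_subset _ _)
            (fun a _ _ => mul_nonneg (Finset.prod_nonneg fun _ _ => norm_nonneg _) hE)
      _ = (∏ j, ∑ b, ‖c j b‖) * E := by
          rw [← Finset.sum_mul, Finset.prod_univ_sum, Fintype.piFinset_univ]
      _ ≤ (∏ _j : Fin n, (4 * p * Real.log p)) * E := by
          refine mul_le_mul_of_nonneg_right (Finset.prod_le_prod (fun j _ => Finset.sum_nonneg fun _ _ => norm_nonneg _)
            (fun j _ => ?_)) hE
          exact L1_bound' _ _ (by have := hAK j; omega)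
      _ = _ := by simp
  rw [← hnorm, norm_mul, norm_pow, Complex.norm_natCast] at hle
  have hre : ‖(((Q.filter (fun x => ∀ j, A j ≤ (y x j).val ∧ (y x j).val < A j + K j)).card : ℂ) -
      Q.card * ∏ j, ((K j : ℂ) / p))‖ = |((Q.filter (fun x => ∀ j, A j ≤ (y x j).val ∧ (y x j).val < A j + K j)).card : ℝ) -
      Q.card * ∏ j, ((K j : ℝ) / p)| := by
    rw [← Real.norm_eq_abs, ← Complex.norm_real]
    push_cast
    rfl
  rw [hre] at hle
  refine le_of_mul_le_mul_left (hle.trans (le_of_eq ?_)) (pow_pos hp0 n)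
  rw [show 4 * (p : ℝ) * Real.log p = p * (4 * Real.log p) by ring, mul_pow]
  ring
end

/-- Discrepancy bound over cubes of integer points: for degree 2 independent polynomials
of total degree at most `d`, the discrepancy of the `(w+1)^m` points
`({G_1(x)/p},…,{G_n(x)/p})`, `x ∈ {u,…,u+w}^m`, is at most
`c p^{1/2} w^{−1} (log p)^{n+1}` with `c = c(m,n,d)`. -/
theorem discrepancy_over_cube (m n d : ℕ) (hm : 0 < m) (hn : 0 < n) :
    ∃ c : ℝ, 0 < c ∧
      ∀ p : ℕ, p.Prime →
        ∀ G : Fin n → MvPolynomial (Fin m) (ZMod p),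
          (∀ j, (G j).totalDegree ≤ d) →
          Degree2Independent G →
          ∀ u w : ℤ, 1 ≤ w → w < (p : ℤ) →
            discrepancy {x : Fin m → ℤ | ∀ i, x i ∈ Set.Icc u (u + w)} (fracPt G)
              ≤ c * Real.sqrt p * (w : ℝ)⁻¹ * Real.log p ^ (n + 1) := by
  classical
  refine ⟨4 ^ (n + 1) * (d + 2) ^ m * d + n * 2 ^ (n + 1) + d * 2 ^ (n + 1) + 1, by positivity, ?_⟩
  intro p hp G hGd hG u w hw1 hwp
  haveI : Fact p.Prime := ⟨hp⟩
  have hp0 : (0 : ℝ) < p := by exact_mod_cast hp.pos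
  have hp2 : (2 : ℝ) ≤ p := by exact_mod_cast hp.two_le
  have hw0 : (1 : ℝ) ≤ w := by exact_mod_cast hw1
  have hwp' : (w : ℝ) ≤ p := by exact_mod_cast hwp.le
  have hsq : 1 ≤ Real.sqrt p := Real.one_le_sqrt.2 (by linarith)
  have hl2 : (1 : ℝ) / 2 ≤ Real.log p := by
    have := Real.log_two_gt_d9.trans_le (Real.log_le_log two_pos hp2)
    linarith
  have hlp : 1 ≤ 2 ^ (n + 1) * Real.log p ^ (n + 1) := by
    rw [← mul_pow]
    exact one_le_pow₀ (by linarith)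
  set W := Real.log p ^ (n + 1) with hW
  have hW0 : 0 ≤ W := by positivity
  set Q := Fintype.piFinset (fun _ : Fin m => Finset.Icc u (u + w)) with hQ
  have hset : {x : Fin m → ℤ | ∀ i, x i ∈ Set.Icc u (u + w)} = (Q : Set (Fin m → ℤ)) := by
    ext x
    rw [Finset.mem_coe, hQ, Fintype.mem_piFinset]
    simp only [Finset.mem_Icc]
    rfl
  have hQcard : (Q.card : ℝ) = ((w : ℝ) + 1) ^ m := by
    rw [hQ, Fintype.card_piFinset, Finset.prod_const, Int.card_Icc, Finset.card_univ, Fintype.card_fin]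
    have : (((u + w + 1 - u).toNat : ℤ) : ℝ) = ((w + 1 : ℤ) : ℝ) := by
      rw [Int.toNat_of_nonneg (by omega)]; congr 1; ring
    rw [Int.cast_natCast] at this
    push_cast
    rw [this]; push_cast; rfl
  have hQpos : (0 : ℝ) < Q.card := by rw [hQcard]; positivity
  rw [hset, discrepancy, if_neg (by rw [Set.ncard_coe_finset]; exact_mod_cast hQpos.ne')]
  have hRHS : 0 ≤ Real.sqrt p * (w : ℝ)⁻¹ * W := by positivity
  apply Real.iSup_le
  swap
  · positivity
  rintro ⟨⟨α, β⟩, hB⟩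
  simp only at hB ⊢
  have hαβ0 : ∀ j, 0 ≤ β j - α j := fun j => by linarith [(hB j).2.1]
  have hαβ1 : ∀ j, β j - α j ≤ 1 := fun j => by linarith [(hB j).1, (hB j).2.2]
  set y : (Fin m → ℤ) → Fin n → ZMod p := fun x j => MvPolynomial.eval (fun i => ((x i : ℤ) : ZMod p)) (G j) with hy
  set A : Fin n → ℕ := fun j => ⌈(p : ℝ) * α j⌉₊ with hA
  set B : Fin n → ℕ := fun j => ⌈(p : ℝ) * β j⌉₊ with hBdef
  have hAB : ∀ j, A j ≤ B j := fun j => Nat.ceil_le_ceil (mul_le_mul_of_nonneg_left (hB j).2.1 hp0.le)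
  have hBp : ∀ j, B j ≤ p := fun j => Nat.ceil_le.2 (mul_le_of_le_one_right hp0.le (hB j).2.2)
  have hinter : (Q : Set (Fin m → ℤ)) ∩ {k | ∀ j, α j ≤ fracPt G k j ∧ fracPt G k j < β j} =
      (Q.filter (fun x => ∀ j, A j ≤ (y x j).val ∧ (y x j).val < A j + (B j - A j)) : Set (Fin m → ℤ)) := by
    ext x
    rw [Finset.coe_filter]
    refine and_congr Iff.rfl (forall_congr' fun j => ?_)
    rw [Nat.add_sub_cancel' (hAB j), hA, hBdef]
    simp only [Nat.ceil_le, Nat.lt_ceil, fracPt]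
    rw [le_div_iff₀' hp0, div_lt_iff₀' hp0]
  rw [hinter, Set.ncard_coe_finset, Set.ncard_coe_finset]
  set N := (Q.filter (fun x => ∀ j, A j ≤ (y x j).val ∧ (y x j).val < A j + (B j - A j))).card with hN
  have hNQ : (N : ℝ) ≤ Q.card := by exact_mod_cast Finset.card_filter_le _ _
  have hP0 : 0 ≤ ∏ j, (β j - α j) := Finset.prod_nonneg fun j _ => hαβ0 j
  have hP1 : ∏ j, (β j - α j) ≤ 1 := Finset.prod_le_one (fun j _ => hαβ0 j) fun j _ => hαβ1 j
  rcases le_or_gt p d with hpd | hpd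
  · have h1 : |(N : ℝ) / Q.card - ∏ j, (β j - α j)| ≤ 1 := by
      have h2 : (N : ℝ) / Q.card ≤ 1 := (div_le_one hQpos).2 hNQ
      have h3 : 0 ≤ (N : ℝ) / Q.card := by positivity
      rw [abs_le]; constructor <;> linarith
    refine h1.trans ?_
    have hpd' : (p : ℝ) ≤ d := by exact_mod_cast hpd
    have h4 : 1 ≤ (d : ℝ) * (w : ℝ)⁻¹ := by
      rw [← div_eq_mul_inv, one_le_div (by linarith)]; linarith
    have h5 : 1 ≤ (d : ℝ) * 2 ^ (n + 1) * (Real.sqrt p * (w : ℝ)⁻¹ * W) := by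
      calc (1 : ℝ) ≤ (d * (w : ℝ)⁻¹) * Real.sqrt p * (2 ^ (n + 1) * W) :=
            one_le_mul_of_one_le_of_one_le (one_le_mul_of_one_le_of_one_le h4 hsq) hlp
        _ = _ := by ring
    have h6 : 0 ≤ (4 ^ (n + 1) * (d + 2 : ℝ) ^ m * d + n * 2 ^ (n + 1) + 1) * (Real.sqrt p * (w : ℝ)⁻¹ * W) := by
      positivity
    nlinarith
  · set E : ℝ := ((d + 2 : ℝ) ^ m * (w : ℝ) ^ (m - 1)) * (4 * d * Real.sqrt p * Real.log p) with hE
    have hE0 : 0 ≤ E := by positivity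
    have hcount := count_est Q y E hE0 (by
      intro a ha
      have h2 := hG a ha
      have hd : (∑ j, a j • G j).totalDegree ≤ d := by
        refine MvPolynomial.totalDegree_finsetSum_le fun j _ => ?_
        exact (MvPolynomial.totalDegree_smul_le _ _).trans (hGd j)
      have := cube_bound (∑ j, a j • G j) h2 hd hpd u w hw1 hwp
      convert this using 4 with x hx
      rw [map_sum]
      simp [hy, MvPolynomial.smul_eval]) A (fun j => B j - A j) (fun j => by
        have := hBp j; have := hAB j; omega)
    rw [← hN] at hcount
    have hK : ∀ j, (((B j - A j : ℕ) : ℝ)) = B j - A j := fun j => Nat.cast_sub (hAB j)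
    have hprod : |∏ j, ((((B j - A j : ℕ) : ℝ)) / p) - ∏ j, (β j - α j)| ≤ n * (1 / p) := by
      have := prod_diff_bound Finset.univ (fun j => ((((B j - A j : ℕ) : ℝ)) / p)) (fun j => β j - α j) (1 / p)
        (fun j _ => ⟨by positivity, (div_le_one hp0).2 (by
          exact_mod_cast (Nat.sub_le _ _).trans (hBp j))⟩) (fun j _ => ⟨hαβ0 j, hαβ1 j⟩) (fun j _ => by
          have e : (((B j - A j : ℕ) : ℝ)) / p - (β j - α j) = ((B j - p * β j) - (A j - p * α j)) / p := by
            rw [hK]; field_simp; ring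
          rw [e, abs_div, abs_of_pos hp0]
          gcongr
          have a1 := Nat.le_ceil ((p : ℝ) * α j)
          have a2 := Nat.ceil_lt_add_one (mul_nonneg hp0.le (hB j).1)
          have b1 := Nat.le_ceil ((p : ℝ) * β j)
          have b2 := Nat.ceil_lt_add_one (mul_nonneg hp0.le ((hB j).1.trans (hB j).2.1))
          rw [abs_le]
          simp only [hA, hBdef]
          constructor <;> linarith)
      simpa using this
    have hfirst : |(N : ℝ) / Q.card - ∏ j, ((((B j - A j : ℕ) : ℝ)) / p)| ≤
        4 ^ (n + 1) * (d + 2) ^ m * d * (Real.sqrt p * (w : ℝ)⁻¹ * W) := by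
      have e : (N : ℝ) / Q.card - ∏ j, ((((B j - A j : ℕ) : ℝ)) / p) =
          (N - Q.card * ∏ j, ((((B j - A j : ℕ) : ℝ)) / p)) / Q.card := by
        field_simp
      rw [e, abs_div, abs_of_pos hQpos, div_le_iff₀ hQpos]
      refine hcount.trans ?_
      have hm' : m - 1 + 1 = m := by omega
      have hwm : (w : ℝ) ^ m ≤ Q.card := by
        rw [hQcard]; gcongr; linarith
      have e2 : (4 * Real.log p) ^ n * E =
          4 ^ (n + 1) * (d + 2) ^ m * d * (Real.sqrt p * (w : ℝ)⁻¹ * W) * (w : ℝ) ^ m := by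
        rw [hE, hW, ← hm', pow_succ (w : ℝ), Nat.add_sub_cancel, mul_pow]
        field_simp
        ring
      rw [e2]
      exact mul_le_mul_of_nonneg_left hwm (by positivity)
    have hsecond : (n : ℝ) * (1 / p) ≤ n * 2 ^ (n + 1) * (Real.sqrt p * (w : ℝ)⁻¹ * W) := by
      have h1 : (1 : ℝ) / p ≤ (w : ℝ)⁻¹ := by
        rw [one_div]; exact inv_anti₀ (by linarith) hwp'
      have h2 : (w : ℝ)⁻¹ ≤ (w : ℝ)⁻¹ * (Real.sqrt p * (2 ^ (n + 1) * W)) :=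
        le_mul_of_one_le_right (by positivity) (one_le_mul_of_one_le_of_one_le hsq hlp)
      calc (n : ℝ) * (1 / p) ≤ n * ((w : ℝ)⁻¹ * (Real.sqrt p * (2 ^ (n + 1) * W))) := by
            gcongr; exact h1.trans h2
        _ = _ := by ring
    have htri := abs_sub_le ((N : ℝ) / Q.card) (∏ j, ((((B j - A j : ℕ) : ℝ)) / p)) (∏ j, (β j - α j))
    have h6 : 0 ≤ ((d : ℝ) * 2 ^ (n + 1) + 1) * (Real.sqrt p * (w : ℝ)⁻¹ * W) := by positivity
    nlinarith
end
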